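/- Fix an integer h ≥ 1 and a positive real number α, and let T_{2,h,α} be the perfect binary tree of height h with every edge weight equal to α. Then n^(2^h) ≲ f₃(T_{2,h,α}; n), and for every ε > 0, f₃(T_{2,h,α}; n) ≲ n^((1/6)(2^(h+3) − 3 + (−1)^h) + ε). Explicitly: there exist a constant c' > 0 and N such that for every n > N some set of n points in ℝ³ contains at least c' · n^(2^h) distance T_{2,h,α}-configurations; and for every ε > 0 there exist constants C and N such that for all n > N, every set of n points in ℝ³ contains at most C · n^((1/6)(2^(h+3) − 3 + (−1)^h) + ε) distance T_{2,h,α}-configurations. -/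

import Mathlib

open scoped InnerProductSpace

noncomputable section

/-- Points in three-dimensional space. -/
abbrev Pt3 : Type := EuclideanSpace ℝ (Fin 3)

/-- The vertex set of the perfect binary rooted tree `T_{2,h}` of height `h`: a vertex is
a list of child-selectors of length at most `h` (the root is the empty list, and the
leaves are the lists of length exactly `h`), so there are `2 ^ h` leaves. -/
def TreeVert (c h : ℕ) : Type := {l : List (Fin c) // l.length ≤ h}

/-- Adjacency in the perfect `c`-ary tree `T_{c,h}`: a vertex is adjacent precisely to its
parent and to its children. -/
def treeAdj (c h : ℕ) (u v : TreeVert c h) : Prop :=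
  (∃ i : Fin c, u.1 = i :: v.1) ∨ (∃ i : Fin c, v.1 = i :: u.1)

/-- The set of distance `T_{c,h,α}`-configurations in a point set `E ⊆ ℝ³`, where every
edge of `T_{c,h}` carries the same weight `α`. -/
def distTreeConfigs3 (c h : ℕ) (α : ℝ) (E : Finset Pt3) : Set (TreeVert c h → Pt3) :=
  {φ | (∀ v, φ v ∈ E) ∧ Function.Injective φ ∧
    ∀ u v, treeAdj c h u v → ‖φ u - φ v‖ = α}

set_option linter.unusedSectionVars false

/-- A reverse form of the Sauer–Shelah inequality: a family has at least as many members as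
there are sets which it strongly shatters. -/
theorem card_stronglyShattered_le {ι : Type*} [DecidableEq ι] (R : Finset ι)
    (S 𝓠 : Finset (Finset ι)) (hS : ∀ I ∈ S, I ⊆ R)
    (hQ : ∀ Q ∈ 𝓠, Q ⊆ R ∧ ∃ J ⊆ R \ Q, ∀ A ⊆ Q, J ∪ A ∈ S) : 𝓠.card ≤ S.card := by
  set 𝓒 : Finset (Finset ι) := R.powerset \ S with h𝓒
  have h1 : 𝓒.card ≤ 𝓒.shatterer.card := Finset.card_le_card_shatterer 𝓒
  have hinj : Set.InjOn (fun Q => R \ Q) (𝓠 : Set (Finset ι)) := by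
    intro a ha b hb hab
    have ha' := (hQ a ha).1
    have hb' := (hQ b hb).1
    simp only at hab
    rw [← Finset.sdiff_sdiff_eq_self ha', ← Finset.sdiff_sdiff_eq_self hb', hab]
  have h2 : 𝓒.shatterer ⊆ R.powerset \ 𝓠.image (fun Q => R \ Q) := by
    intro s hs
    rw [Finset.mem_shatterer] at hs
    rw [Finset.mem_sdiff, Finset.mem_powerset]
    constructor
    · obtain ⟨u, hu, hsu⟩ := hs (Finset.Subset.refl s)
      rw [h𝓒, Finset.mem_sdiff, Finset.mem_powerset] at hu
      intro x hx
      rw [← hsu] at hx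
      exact hu.1 (Finset.mem_inter.1 hx).2
    · intro hmem
      obtain ⟨Q, hQm, rfl⟩ := Finset.mem_image.1 hmem
      obtain ⟨hQR, J, hJ, hall⟩ := hQ Q hQm
      obtain ⟨u, hu, hsu⟩ := hs hJ
      rw [h𝓒, Finset.mem_sdiff, Finset.mem_powerset] at hu
      apply hu.2
      have : u = J ∪ (u ∩ Q) := by
        ext x
        rw [← hsu]
        simp only [Finset.mem_union, Finset.mem_inter, Finset.mem_sdiff]
        have := @hu.1 x
        tauto
      rw [this]
      exact hall _ Finset.inter_subset_right
  have h3 := Finset.card_le_card h2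
  have h4 : 𝓠.image (fun Q => R \ Q) ⊆ R.powerset := by
    intro x hx
    obtain ⟨Q, -, rfl⟩ := Finset.mem_image.1 hx
    exact Finset.mem_powerset.2 Finset.sdiff_subset
  have h5 : S ⊆ R.powerset := fun I hI => Finset.mem_powerset.2 (hS I hI)
  rw [Finset.card_sdiff_of_subset h4, Finset.card_image_of_injOn hinj] at h3
  have hc : 𝓒.card = R.powerset.card - S.card := Finset.card_sdiff_of_subset h5
  have h6 := Finset.card_le_card h4
  rw [Finset.card_image_of_injOn hinj] at h6
  have h7 := Finset.card_le_card h5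
  omega

/-- A random sample of size `m` hits every member of a family of large sets. -/
theorem exists_hittingSet {ι : Type*} [Fintype ι] [DecidableEq ι] (𝓕 : Finset (Finset ι))
    (K m : ℕ) (h𝓕 : ∀ G ∈ 𝓕, K ≤ G.card)
    (hm : 𝓕.card * (Fintype.card ι - K) ^ m < Fintype.card ι ^ m) :
    ∃ R : Finset ι, R.card ≤ m ∧ ∀ G ∈ 𝓕, (R ∩ G).Nonempty := by
  by_contra! hcon
  have hsub : (Finset.univ : Finset (Fin m → ι)) ⊆
      𝓕.biUnion (fun G => Fintype.piFinset (fun _ : Fin m => Gᶜ)) := by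
    intro f _
    obtain ⟨G, hG, hGe⟩ := hcon (Finset.univ.image f) (by
      simpa using Finset.card_image_le (s := (Finset.univ : Finset (Fin m))) (f := f))
    refine Finset.mem_biUnion.2 ⟨G, hG, Fintype.mem_piFinset.2 fun i => ?_⟩
    rw [Finset.mem_compl]
    intro hi
    have : f i ∈ Finset.univ.image f ∩ G :=
      Finset.mem_inter.2 ⟨Finset.mem_image_of_mem _ (Finset.mem_univ _), hi⟩
    rw [hGe] at this
    simp at this
  have h1 := Finset.card_le_card hsub
  have h2 : (𝓕.biUnion (fun G => Fintype.piFinset (fun _ : Fin m => Gᶜ))).card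
      ≤ 𝓕.card * (Fintype.card ι - K) ^ m := by
    refine Finset.card_biUnion_le_card_mul _ _ _ fun G hG => ?_
    rw [Fintype.card_piFinset_const, Finset.card_compl]
    exact Nat.pow_le_pow_left (by have := h𝓕 G hG; omega) _
  simp only [Finset.card_univ, Fintype.card_fun, Fintype.card_fin] at h1
  omega

/-- A deletion recurrence for a function on finite sets, resolved up to a harmonic factor. -/
theorem le_of_deletion_recurrence {ι : Type*} [DecidableEq ι] (E : Finset ι → ℝ) (K lam : ℝ)
    (N : ℕ) (hK : 0 ≤ K) (hlam : 1 + (harmonic N : ℝ) ≤ lam)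
    (hbase : ∀ R, R.card = 3 → E R ≤ 6 * K)
    (hrec : ∀ R, 4 ≤ R.card → R.card ≤ N →
      ((R.card : ℝ) - 3) * E R ≤ (∑ h ∈ R, E (R.erase h)) + K * (R.card.descFactorial 3 : ℝ))
    (R : Finset ι) (h3 : 3 ≤ R.card) (hN : R.card ≤ N) :
    E R ≤ K * lam * (R.card.descFactorial 3 : ℝ) := by
  have key : ∀ r : ℕ, r + 3 ≤ N → ∀ R : Finset ι, R.card = r + 3 →
      E R ≤ K * (1 + (harmonic r : ℝ)) * ((r + 3).descFactorial 3 : ℝ) := by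
    intro r
    induction r with
    | zero =>
      intro _ R hR
      have := hbase R (by omega)
      simp [Nat.descFactorial]
      linarith
    | succ r ih =>
      intro hrN R hR
      have h1 := hrec R (by omega) (by omega)
      have h2 : ∑ h ∈ R, E (R.erase h) ≤
          ∑ h ∈ R, K * (1 + (harmonic r : ℝ)) * ((r + 3).descFactorial 3 : ℝ) := by
        refine Finset.sum_le_sum fun h hh => ih (by omega) _ ?_
        rw [Finset.card_erase_of_mem hh]; omega
      rw [Finset.sum_const, nsmul_eq_mul, hR] at h2
      rw [hR] at h1
      have hd1 : ((r + 3).descFactorial 3 : ℝ) = (r + 3) * (r + 2) * (r + 1) := by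
        simp only [Nat.descFactorial]
        push_cast [show r + 3 - 2 = r + 1 by omega, show r + 3 - 1 = r + 2 by omega]
        ring
      have hd2 : ((r + 1 + 3).descFactorial 3 : ℝ) = (r + 4) * (r + 3) * (r + 2) := by
        simp only [Nat.descFactorial]
        push_cast [show r + 1 + 3 - 2 = r + 2 by omega, show r + 1 + 3 - 1 = r + 3 by omega]
        ring
      rw [hd1] at h2
      rw [hd2] at h1 ⊢
      rw [harmonic_succ]
      push_cast at h1 h2 ⊢
      have hr : (0 : ℝ) < r + 1 := by positivity
      have h3 : ((r : ℝ) + 1) * E R ≤ ((r : ℝ) + 1) *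
          (K * (1 + ((harmonic r : ℝ) + ((r : ℝ) + 1)⁻¹)) * ((r + 4) * (r + 3) * (r + 2))) := by
        have : ((r : ℝ) + 1) *
          (K * (1 + ((harmonic r : ℝ) + ((r : ℝ) + 1)⁻¹)) * ((r + 4) * (r + 3) * (r + 2)))
          = (r + 1 + 3) * (K * (1 + (harmonic r : ℝ)) * ((r + 3) * (r + 2) * (r + 1)))
            + K * ((r + 4) * (r + 3) * (r + 2)) := by
          field_simp
          ring
        rw [this]
        linarith
      exact le_of_mul_le_mul_left h3 hr
  obtain ⟨r, hr⟩ := Nat.exists_eq_add_of_le' h3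
  have h := key r (by omega) R hr
  rw [hr]
  refine h.trans ?_
  gcongr
  refine le_trans ?_ hlam
  gcongr
  have hmono : harmonic r ≤ harmonic N := by
    unfold harmonic
    refine Finset.sum_le_sum_of_subset_of_nonneg (Finset.range_mono (by omega)) fun i _ _ => ?_
    positivity
  exact_mod_cast hmono

section

variable {ι W : Type*} [DecidableEq ι] [AddCommGroup W] [Module ℝ W]

/-- Any five of the functionals `ℓ` have trivial common kernel. -/
def InGeneralPosition (ℓ : ι → W →ₗ[ℝ] ℝ) : Prop :=
  ∀ Q : Finset ι, Q.card = 5 → ∀ X : W, (∀ i ∈ Q, ℓ i X = 0) → X = 0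

/-- `v Q` spans the common kernel of the functionals indexed by a four-element set `Q`. -/
def SpansKernels (ℓ : ι → W →ₗ[ℝ] ℝ) (v : Finset ι → W) : Prop :=
  ∀ Q : Finset ι, Q.card = 4 → v Q ≠ 0 ∧ ∀ X : W, (∀ i ∈ Q, ℓ i X = 0) ↔ ∃ t : ℝ, X = t • v Q

/-- The functionals indexed by `D` are negative at `X` on `I` and positive off `I`. -/
def MatchesOn (ℓ : ι → W →ₗ[ℝ] ℝ) (I D : Finset ι) (X : W) : Prop :=
  ∀ c ∈ D, (c ∈ I → ℓ c X < 0) ∧ (c ∉ I → 0 < ℓ c X)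

/-- One of the two opposite generators of the line spanned by `v Q`. -/
def signedRay (v : Finset ι → W) (Q : Finset ι) (s : Bool) : W := if s then v Q else -v Q

theorem exists_ne_zero_kernel [FiniteDimensional ℝ W] (hW : Module.finrank ℝ W = 5)
    (ℓ : ι → W →ₗ[ℝ] ℝ) (Q : Finset ι) (hQ : Q.card ≤ 4) :
    ∃ X : W, X ≠ 0 ∧ ∀ i ∈ Q, ℓ i X = 0 := by
  let f : W →ₗ[ℝ] (Q → ℝ) := LinearMap.pi fun i => ℓ i
  have h : LinearMap.ker f ≠ ⊥ := by
    apply LinearMap.ker_ne_bot_of_finrank_lt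
    simp only [Module.finrank_fintype_fun_eq_card, Fintype.card_coe]
    omega
  obtain ⟨X, hX, hX0⟩ := Submodule.exists_mem_ne_zero_of_ne_bot h
  refine ⟨X, hX0, fun i hi => ?_⟩
  exact congrFun (LinearMap.mem_ker.1 hX) ⟨i, hi⟩

theorem InGeneralPosition.ne_zero {ℓ : ι → W →ₗ[ℝ] ℝ} (hℓ : InGeneralPosition ℓ)
    {Q : Finset ι} (hQ : Q.card = 4) {X : W} (hX : X ≠ 0) (h0 : ∀ i ∈ Q, ℓ i X = 0) {i : ι}
    (hi : i ∉ Q) : ℓ i X ≠ 0 := by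
  intro h
  refine hX (hℓ (insert i Q) (by rw [Finset.card_insert_of_notMem hi, hQ]) X ?_)
  intro j hj
  rcases Finset.mem_insert.1 hj with rfl | hj
  · exact h
  · exact h0 j hj

theorem InGeneralPosition.exists_spansKernels [Fintype ι] [FiniteDimensional ℝ W]
    (hW : Module.finrank ℝ W = 5) (hι : 5 ≤ Fintype.card ι) {ℓ : ι → W →ₗ[ℝ] ℝ}
    (hℓ : InGeneralPosition ℓ) : ∃ v : Finset ι → W, SpansKernels ℓ v := by
  have h : ∀ Q : Finset ι, ∃ X : W, Q.card = 4 → X ≠ 0 ∧ ∀ i ∈ Q, ℓ i X = 0 := by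
    intro Q
    by_cases hQ : Q.card = 4
    · obtain ⟨X, hX⟩ := exists_ne_zero_kernel hW ℓ Q hQ.le
      exact ⟨X, fun _ => hX⟩
    · exact ⟨0, fun h => absurd h hQ⟩
  choose v hv using h
  refine ⟨v, fun Q hQ => ⟨(hv Q hQ).1, fun X => ⟨fun hX => ?_, ?_⟩⟩⟩
  · obtain ⟨i, hi⟩ : ∃ i, i ∉ Q := by
      by_contra! hall
      have : Q = Finset.univ := Finset.eq_univ_iff_forall.2 hall
      rw [this, Finset.card_univ] at hQ
      omega
    have hne := hℓ.ne_zero hQ (hv Q hQ).1 (hv Q hQ).2 hi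
    refine ⟨ℓ i X / ℓ i (v Q), ?_⟩
    by_contra hX0
    refine hℓ.ne_zero hQ (sub_ne_zero.2 hX0) ?_ hi ?_
    · intro j hj
      simp [hX j hj, (hv Q hQ).2 j hj]
    · simp only [map_sub, map_smul, smul_eq_mul]
      field_simp
      ring
  · rintro ⟨t, rfl⟩ i hi
    simp [(hv Q hQ).2 i hi]

theorem SpansKernels.signedRay_ne_zero {ℓ : ι → W →ₗ[ℝ] ℝ} {v : Finset ι → W}
    (hv : SpansKernels ℓ v) {Q : Finset ι} (hQ : Q.card = 4) (s : Bool) :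
    signedRay v Q s ≠ 0 := by
  unfold signedRay
  split
  · exact (hv Q hQ).1
  · exact neg_ne_zero.2 (hv Q hQ).1

theorem SpansKernels.apply_signedRay {ℓ : ι → W →ₗ[ℝ] ℝ} {v : Finset ι → W}
    (hv : SpansKernels ℓ v) {Q : Finset ι} (hQ : Q.card = 4) (s : Bool) {i : ι} (hi : i ∈ Q) :
    ℓ i (signedRay v Q s) = 0 := by
  have := ((hv Q hQ).2 (v Q)).2 ⟨1, by simp⟩ i hi
  unfold signedRay
  split <;> simp [this]

/-- A nonzero vector of the kernel of four functionals is a positive multiple of a signed ray. -/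
theorem SpansKernels.exists_signedRay {ℓ : ι → W →ₗ[ℝ] ℝ} {v : Finset ι → W}
    (hv : SpansKernels ℓ v) {Q : Finset ι} (hQ : Q.card = 4) {X : W} (hX0 : X ≠ 0)
    (hX : ∀ i ∈ Q, ℓ i X = 0) : ∃ (s : Bool) (t : ℝ), 0 < t ∧ X = t • signedRay v Q s := by
  obtain ⟨t, rfl⟩ := ((hv Q hQ).2 X).1 hX
  have ht : t ≠ 0 := by rintro rfl; simp at hX0
  rcases lt_or_gt_of_ne ht with h | h
  · exact ⟨false, -t, by linarith, by simp [signedRay]⟩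
  · exact ⟨true, t, h, by simp [signedRay]⟩

variable (ℓ : ι → W →ₗ[ℝ] ℝ) (v : Finset ι → W) (𝓘 : Finset ι → Finset (Finset ι))

open Classical in
/-- Signed rays `(Q, s)` bounding simultaneously all the cells `I ∪ B'` with `B' ⊆ B`, where
`B ⊆ Q` has `j` elements. -/
def vertexFlags (R : Finset ι) (j : ℕ) : Finset (Finset ι × Bool × Finset ι × Finset ι) :=
  (R.powersetCard 4 ×ˢ Finset.univ ×ˢ R.powersetCard j ×ˢ R.powerset).filter fun x =>
    x.2.2.1 ⊆ x.1 ∧ Disjoint x.2.2.2 x.2.2.1 ∧ (∀ B' ⊆ x.2.2.1, x.2.2.2 ∪ B' ∈ 𝓘 R) ∧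
      MatchesOn ℓ x.2.2.2 (R \ x.1) (signedRay v x.1 x.2.1)

open Classical in
/-- Two-dimensional kernels of triples `F` meeting all the cells `I ∪ B'` with `B' ⊆ B`, where
`B ⊆ F` has `j` elements. -/
def edgeFlags (R : Finset ι) (j : ℕ) : Finset (Finset ι × Finset ι × Finset ι) :=
  (R.powersetCard 3 ×ˢ R.powersetCard j ×ˢ R.powerset).filter fun x =>
    x.2.1 ⊆ x.1 ∧ Disjoint x.2.2 x.2.1 ∧ (∀ B' ⊆ x.2.1, x.2.2 ∪ B' ∈ 𝓘 R) ∧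
      ∃ X : W, (∀ i ∈ x.1, ℓ i X = 0) ∧ MatchesOn ℓ x.2.2 (R \ x.1) X

variable {ℓ v 𝓘}

theorem mem_vertexFlags {R : Finset ι} {j : ℕ} {Q B I : Finset ι} {s : Bool} :
    (Q, s, B, I) ∈ vertexFlags ℓ v 𝓘 R j ↔ (Q ⊆ R ∧ Q.card = 4) ∧ (B ⊆ Q ∧ B.card = j) ∧
      I ⊆ R ∧ Disjoint I B ∧ (∀ B' ⊆ B, I ∪ B' ∈ 𝓘 R) ∧
      MatchesOn ℓ I (R \ Q) (signedRay v Q s) := by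
  simp only [vertexFlags, Finset.mem_filter, Finset.mem_product, Finset.mem_powersetCard,
    Finset.mem_univ, Finset.mem_powerset, true_and]
  constructor
  · tauto
  · rintro ⟨h1, h2, h3⟩
    have := h2.1.trans h1.1
    tauto

theorem mem_edgeFlags {R : Finset ι} {j : ℕ} {F B I : Finset ι} :
    (F, B, I) ∈ edgeFlags ℓ 𝓘 R j ↔ (F ⊆ R ∧ F.card = 3) ∧ (B ⊆ F ∧ B.card = j) ∧
      I ⊆ R ∧ Disjoint I B ∧ (∀ B' ⊆ B, I ∪ B' ∈ 𝓘 R) ∧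
      ∃ X : W, (∀ i ∈ F, ℓ i X = 0) ∧ MatchesOn ℓ I (R \ F) X := by
  simp only [edgeFlags, Finset.mem_filter, Finset.mem_product, Finset.mem_powersetCard,
    Finset.mem_powerset]
  constructor
  · tauto
  · rintro ⟨h1, h2, h3⟩
    have := h2.1.trans h1.1
    tauto

theorem card_edgeFlags_le_of_card_eq_three {R : Finset ι} (hR : R.card = 3) (j : ℕ) :
    (edgeFlags ℓ 𝓘 R j).card ≤ 64 := by
  classical
  have h : edgeFlags ℓ 𝓘 R j ⊆ R.powersetCard 3 ×ˢ R.powerset ×ˢ R.powerset := by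
    rintro ⟨F, B, I⟩ h
    rw [mem_edgeFlags] at h
    simp only [Finset.mem_product, Finset.mem_powersetCard, Finset.mem_powerset]
    exact ⟨h.1, h.2.1.1.trans h.1.1, h.2.2.1⟩
  refine (Finset.card_le_card h).trans ?_
  simp [Finset.card_product, hR]

theorem card_vertexFlags_four_le (h𝓘 : ∀ R, ∀ I ∈ 𝓘 R, I ⊆ R) (R : Finset ι) :
    (vertexFlags ℓ v 𝓘 R 4).card ≤ 2 * (𝓘 R).card := by
  classical
  have hfst : ∀ {Q s B I}, (Q, s, B, I) ∈ vertexFlags ℓ v 𝓘 R 4 → B = Q := by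
    intro Q s B I h
    rw [mem_vertexFlags] at h
    exact Finset.eq_of_subset_of_card_le h.2.1.1 (by omega)
  set 𝓠 := (vertexFlags ℓ v 𝓘 R 4).image fun x => x.1 with h𝓠
  have h1 : 𝓠.card ≤ (𝓘 R).card := by
    refine card_stronglyShattered_le R _ _ (h𝓘 R) ?_
    intro Q hQ
    obtain ⟨⟨Q, s, B, I⟩, hx, rfl⟩ := Finset.mem_image.1 hQ
    obtain rfl := hfst hx
    rw [mem_vertexFlags] at hx
    refine ⟨hx.1.1, I, ?_, hx.2.2.2.2.1⟩
    intro i hi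
    exact Finset.mem_sdiff.2 ⟨hx.2.2.1 hi, Finset.disjoint_left.1 hx.2.2.2.1 hi⟩
  have h2 : (vertexFlags ℓ v 𝓘 R 4).card ≤ (𝓠 ×ˢ (Finset.univ : Finset Bool)).card := by
    refine Finset.card_le_card_of_injOn (fun x => (x.1, x.2.1)) ?_ ?_
    · intro x hx
      simp only [Finset.coe_product, Set.mem_prod, Finset.mem_coe]
      exact ⟨Finset.mem_image_of_mem _ hx, Finset.mem_univ _⟩
    · rintro ⟨Q, s, B, I⟩ hx ⟨Q', s', B', I'⟩ hx' heq
      obtain rfl := hfst hx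
      obtain rfl := hfst hx'
      simp only [Prod.mk.injEq] at heq
      obtain ⟨rfl, rfl⟩ := heq
      rw [Finset.mem_coe, mem_vertexFlags] at hx hx'
      have : I = I' := by
        ext i
        constructor
        · intro hi
          by_contra hi'
          have hm : i ∈ R \ B :=
            Finset.mem_sdiff.2 ⟨hx.2.2.1 hi, Finset.disjoint_left.1 hx.2.2.2.1 hi⟩
          have a := (hx.2.2.2.2.2 i hm).1 hi
          have b := (hx'.2.2.2.2.2 i hm).2 hi'
          linarith
        · intro hi
          by_contra hi'
          have hm : i ∈ R \ B :=
            Finset.mem_sdiff.2 ⟨hx'.2.2.1 hi, Finset.disjoint_left.1 hx'.2.2.2.1 hi⟩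
          have a := (hx'.2.2.2.2.2 i hm).1 hi
          have b := (hx.2.2.2.2.2 i hm).2 hi'
          linarith
      rw [this]
  rw [Finset.card_product, Finset.card_univ, Fintype.card_bool] at h2
  omega

end

section

variable {ι W : Type*} [DecidableEq ι] [AddCommGroup W] [Module ℝ W]
variable {ℓ : ι → W →ₗ[ℝ] ℝ} {v : Finset ι → W} {𝓘 : Finset ι → Finset (Finset ι)}

theorem MatchesOn.mono {I D D' : Finset ι} {X : W} (h : MatchesOn ℓ I D X) (hD : D' ⊆ D) :
    MatchesOn ℓ I D' X := fun c hc => h c (hD hc)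

theorem MatchesOn.of_smul {I D : Finset ι} {X : W} {t : ℝ} (ht : 0 < t)
    (h : MatchesOn ℓ I D (t • X)) : MatchesOn ℓ I D X := by
  intro c hc
  have := h c hc
  simp only [map_smul, smul_eq_mul] at this
  exact ⟨fun hi => (pos_iff_neg_of_mul_neg (this.1 hi)).1 ht, fun hi => (pos_iff_pos_of_mul_pos (this.2 hi)).1 ht⟩

theorem MatchesOn.perturb {I D : Finset ι} {X : W} (h : MatchesOn ℓ I D X) (w : W) :
    ∀ᶠ e in nhdsWithin (0 : ℝ) (Set.Ioi 0), MatchesOn ℓ I D (X + e • w) := by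
  unfold MatchesOn
  rw [Filter.eventually_all_finset]
  intro c hc
  have hcont : Filter.Tendsto (fun e : ℝ => ℓ c (X + e • w)) (nhdsWithin (0 : ℝ) (Set.Ioi 0))
      (nhds (ℓ c X)) := by
    have : Continuous fun e : ℝ => ℓ c X + e * ℓ c w := by fun_prop
    have h0 := (this.tendsto 0).mono_left (nhdsWithin_le_nhds (s := Set.Ioi 0))
    simpa using h0
  by_cases hi : c ∈ I
  · filter_upwards [hcont.eventually (gt_mem_nhds ((h c hc).1 hi))] with e he
    exact ⟨fun _ => he, fun h' => absurd hi h'⟩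
  · filter_upwards [hcont.eventually (lt_mem_nhds ((h c hc).2 hi))] with e he
    exact ⟨fun h' => absurd h' hi, fun _ => he⟩

/-- A plane `ker F` contains at most two lines of the arrangement bounding a given cell. -/
theorem not_three_rays (hℓ : InGeneralPosition ℓ) {F I : Finset ι} (hF : F.card = 3)
    {h₁ h₂ h₃ : ι} (m₁ : h₁ ∉ F) (m₂ : h₂ ∉ F) (h12 : h₁ ≠ h₂)
    {u₁ u₂ u₃ : W} (k₁ : ∀ i ∈ F, ℓ i u₁ = 0) (k₂ : ∀ i ∈ F, ℓ i u₂ = 0)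
    (k₃ : ∀ i ∈ F, ℓ i u₃ = 0) (z₁ : ℓ h₁ u₁ = 0) (z₂ : ℓ h₂ u₂ = 0) (z₃ : ℓ h₃ u₃ = 0)
    (s₁ : MatchesOn ℓ I {h₂, h₃} u₁) (s₂ : MatchesOn ℓ I {h₁, h₃} u₂)
    (s₃ : MatchesOn ℓ I {h₁, h₂} u₃) : False := by
  have same : ∀ {c : ι} {D D' : Finset ι} {X Y : W}, MatchesOn ℓ I D X → MatchesOn ℓ I D' Y →
      c ∈ D → c ∈ D' → 0 < ℓ c X * ℓ c Y := by
    intro c D D' X Y hX hY hc hc'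
    by_cases hi : c ∈ I
    · exact mul_pos_of_neg_of_neg ((hX c hc).1 hi) ((hY c hc').1 hi)
    · exact mul_pos ((hX c hc).2 hi) ((hY c hc').2 hi)
  have a12 : 0 < ℓ h₂ u₃ * ℓ h₂ u₁ := same s₃ s₁ (by simp) (by simp)
  have a13 : 0 < ℓ h₁ u₃ * ℓ h₁ u₂ := same s₃ s₂ (by simp) (by simp)
  have a3 : 0 < ℓ h₃ u₁ * ℓ h₃ u₂ := same s₁ s₂ (by simp) (by simp)
  have n1 : ℓ h₂ u₁ ≠ 0 := fun h => by simp [h] at a12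
  have n2 : ℓ h₁ u₂ ≠ 0 := fun h => by simp [h] at a13
  set s := ℓ h₂ u₃ / ℓ h₂ u₁ with hs
  set t := ℓ h₁ u₃ / ℓ h₁ u₂ with ht
  have spos : 0 < s := div_pos_iff.2 (mul_pos_iff.1 a12)
  have tpos : 0 < t := div_pos_iff.2 (mul_pos_iff.1 a13)
  have hZ : u₃ - s • u₁ - t • u₂ = 0 := by
    refine hℓ (insert h₁ (insert h₂ F)) ?_ _ ?_
    · rw [Finset.card_insert_of_notMem (by simp [h12, m₁]), Finset.card_insert_of_notMem m₂, hF]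
    · intro i hi
      simp only [Finset.mem_insert] at hi
      simp only [map_sub, map_smul, smul_eq_mul]
      rcases hi with rfl | rfl | hi
      · rw [z₁, ht]; field_simp; ring
      · rw [z₂, hs]; field_simp; ring
      · simp [k₁ i hi, k₂ i hi, k₃ i hi]
  have h3 : ℓ h₃ (u₃ - s • u₁ - t • u₂) = 0 := by rw [hZ, map_zero]
  simp only [map_sub, map_smul, smul_eq_mul, z₃] at h3
  rcases mul_pos_iff.1 a3 with ⟨p, q⟩ | ⟨p, q⟩
  · nlinarith [mul_pos spos p, mul_pos tpos q]
  · nlinarith [mul_neg_of_pos_of_neg spos p, mul_neg_of_pos_of_neg tpos q]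

theorem eq_insert_of_card {F Q : Finset ι} (h : F ⊆ Q) (hF : F.card = 3) (hQ : Q.card = 4) :
    ∃ h ∉ F, Q = insert h F := by
  have : (Q \ F).card = 1 := by rw [Finset.card_sdiff_of_subset h]; omega
  obtain ⟨a, ha⟩ := Finset.card_eq_one.1 this
  refine ⟨a, ?_, ?_⟩
  · exact (Finset.mem_sdiff.1 (ha ▸ Finset.mem_singleton_self a)).2
  · rw [Finset.insert_eq, ← ha, Finset.sdiff_union_of_subset h]

theorem card_vertexFlags_le [Fintype ι] (hι : 5 ≤ Fintype.card ι) (hℓ : InGeneralPosition ℓ)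
    (hv : SpansKernels ℓ v) (R : Finset ι) {j : ℕ} (hj : j ≤ 3) :
    (vertexFlags ℓ v 𝓘 R j).card ≤ 4 * (edgeFlags ℓ 𝓘 R j).card := by
  classical
  have hex : ∀ Q B : Finset ι, ∃ F : Finset ι, B ⊆ Q → Q.card = 4 → B.card = j →
      B ⊆ F ∧ F ⊆ Q ∧ F.card = 3 := by
    intro Q B
    by_cases h : B ⊆ Q ∧ Q.card = 4 ∧ B.card = j
    · obtain ⟨F, h1, h2, h3⟩ := Finset.exists_subsuperset_card_eq h.1 (n := 3) (by omega) (by omega)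
      exact ⟨F, fun _ _ _ => ⟨h1, h2, h3⟩⟩
    · exact ⟨∅, fun a b c => absurd ⟨a, b, c⟩ h⟩
  choose F hF using hex
  set f : Finset ι × Bool × Finset ι × Finset ι → Finset ι × Finset ι × Finset ι :=
    fun x => (F x.1 x.2.2.1, x.2.2.1, x.2.2.2) with hf
  have hsub : (vertexFlags ℓ v 𝓘 R j).image f ⊆ edgeFlags ℓ 𝓘 R j := by
    intro y hy
    obtain ⟨⟨Q, s, B, I⟩, hx, rfl⟩ := Finset.mem_image.1 hy
    rw [mem_vertexFlags] at hx
    obtain ⟨⟨hQR, hQ⟩, ⟨hBQ, hB⟩, hIR, hd, hB', hm⟩ := hx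
    obtain ⟨f1, f2, f3⟩ := hF Q B hBQ hQ hB
    refine mem_edgeFlags.2 ⟨⟨f2.trans hQR, f3⟩, ⟨f1, hB⟩, hIR, hd, hB', ?_⟩
    obtain ⟨h, hh, hQh⟩ := eq_insert_of_card f2 f3 hQ
    obtain ⟨h0, hh0⟩ : ∃ i, i ∉ Q := by
      by_contra! hall
      rw [Finset.eq_univ_iff_forall.2 hall, Finset.card_univ] at hQ
      omega
    have h0F : h0 ∉ F Q B := fun h => hh0 (f2 h)
    have hc : (insert h0 (F Q B)).card = 4 := by rw [Finset.card_insert_of_notMem h0F, f3]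
    set w := v (insert h0 (F Q B)) with hw
    have hw0 : ∀ i ∈ insert h0 (F Q B), ℓ i w = 0 := ((hv _ hc).2 w).2 ⟨1, by simp [hw]⟩
    have hhQ : h ∈ Q := by rw [hQh]; simp
    have hwh : ℓ h w ≠ 0 := hℓ.ne_zero hc (hv _ hc).1 hw0 (by
      simp only [Finset.mem_insert, not_or]
      exact ⟨fun e => hh0 (e ▸ hhQ), hh⟩)
    obtain ⟨w', hw'0, hw'⟩ : ∃ w' : W, (∀ i ∈ F Q B, ℓ i w' = 0) ∧
        (h ∈ I → ℓ h w' < 0) ∧ (h ∉ I → 0 < ℓ h w') := by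
      refine ⟨(if h ∈ I then -(ℓ h w) else ℓ h w) • w, fun i hi => ?_, fun hi => ?_, fun hi => ?_⟩
      · rw [map_smul, hw0 i (Finset.mem_insert_of_mem hi), smul_zero]
      · simp only [hi, if_true, map_smul, smul_eq_mul]
        nlinarith [mul_self_pos.2 hwh]
      · simp only [hi, if_false, map_smul, smul_eq_mul]
        exact mul_self_pos.2 hwh
    obtain ⟨e, hme, he⟩ := ((hm.perturb w').and self_mem_nhdsWithin).exists
    replace he : 0 < e := he
    refine ⟨signedRay v Q s + e • w', fun i hi => ?_, fun c hc' => ?_⟩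
    · simp [hv.apply_signedRay hQ s (f2 hi), hw'0 i hi]
    · by_cases hch : c = h
      · subst hch
        simp only [map_add, map_smul, smul_eq_mul, hv.apply_signedRay hQ s hhQ, zero_add]
        exact ⟨fun hi => mul_neg_of_pos_of_neg he (hw'.1 hi), fun hi => mul_pos he (hw'.2 hi)⟩
      · refine hme c ?_
        have h2 := Finset.mem_sdiff.1 hc'
        rw [hQh, Finset.mem_sdiff, Finset.mem_insert]
        exact ⟨h2.1, by rintro (h | h); exacts [hch h, h2.2 h]⟩
  refine (Finset.card_le_mul_card_image (f := f) _ 4 ?_).trans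
    (Nat.mul_le_mul_left 4 (Finset.card_le_card hsub))
  rintro ⟨F', B, I⟩ -
  set X := (vertexFlags ℓ v 𝓘 R j).filter fun x => f x = (F', B, I) with hX
  have hXm : ∀ Q s B₀ I₀, (Q, s, B₀, I₀) ∈ X → B₀ = B ∧ I₀ = I ∧ F' ⊆ Q ∧ F'.card = 3 ∧
      Q ⊆ R ∧ Q.card = 4 ∧ MatchesOn ℓ I (R \ Q) (signedRay v Q s) := by
    intro Q s B₀ I₀ h
    rw [hX, Finset.mem_filter, mem_vertexFlags] at h
    obtain ⟨⟨⟨hQR, hQ⟩, ⟨hBQ, hB⟩, hIR, hd, hB', hm⟩, heq⟩ := h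
    simp only [hf, Prod.mk.injEq] at heq
    obtain ⟨rfl, rfl, rfl⟩ := heq
    obtain ⟨f1, f2, f3⟩ := hF Q B₀ hBQ hQ hB
    exact ⟨rfl, rfl, f2, f3, hQR, hQ, hm⟩
  have hH : (X.image fun x => x.1).card ≤ 2 := by
    by_contra! hlt
    obtain ⟨Q₁, Q₂, Q₃, hQ₁, hQ₂, hQ₃, n12, n13, n23⟩ := Finset.two_lt_card_iff.1 hlt
    obtain ⟨⟨Q₁, s₁, B₁, I₁⟩, hx₁, rfl⟩ := Finset.mem_image.1 hQ₁
    obtain ⟨⟨Q₂, s₂, B₂, I₂⟩, hx₂, rfl⟩ := Finset.mem_image.1 hQ₂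
    obtain ⟨⟨Q₃, s₃, B₃, I₃⟩, hx₃, rfl⟩ := Finset.mem_image.1 hQ₃
    obtain ⟨-, -, a₁, c, b₁, d₁, e₁⟩ := hXm _ _ _ _ hx₁
    obtain ⟨-, -, a₂, -, b₂, d₂, e₂⟩ := hXm _ _ _ _ hx₂
    obtain ⟨-, -, a₃, -, b₃, d₃, e₃⟩ := hXm _ _ _ _ hx₃
    obtain ⟨h₁, m₁, i₁⟩ := eq_insert_of_card a₁ c d₁
    obtain ⟨h₂, m₂, i₂⟩ := eq_insert_of_card a₂ c d₂
    obtain ⟨h₃, m₃, i₃⟩ := eq_insert_of_card a₃ c d₃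
    have hm₁ : h₁ ∈ Q₁ := by simp [i₁]
    have hm₂ : h₂ ∈ Q₂ := by simp [i₂]
    have hm₃ : h₃ ∈ Q₃ := by simp [i₃]
    have k12 : h₁ ≠ h₂ := by rintro rfl; exact n12 (i₁.trans i₂.symm)
    have k13 : h₁ ≠ h₃ := by rintro rfl; exact n13 (i₁.trans i₃.symm)
    have k23 : h₂ ≠ h₃ := by rintro rfl; exact n23 (i₂.trans i₃.symm)
    refine not_three_rays (I := I) hℓ c m₁ m₂ k12 (u₁ := signedRay v Q₁ s₁)
      (u₂ := signedRay v Q₂ s₂) (u₃ := signedRay v Q₃ s₃) (h₃ := h₃)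
      (fun i hi => hv.apply_signedRay d₁ _ (a₁ hi)) (fun i hi => hv.apply_signedRay d₂ _ (a₂ hi))
      (fun i hi => hv.apply_signedRay d₃ _ (a₃ hi)) (hv.apply_signedRay d₁ _ hm₁)
      (hv.apply_signedRay d₂ _ hm₂) (hv.apply_signedRay d₃ _ hm₃) (e₁.mono ?_) (e₂.mono ?_)
      (e₃.mono ?_)
    · intro x hx
      simp only [Finset.mem_insert, Finset.mem_singleton] at hx
      rw [Finset.mem_sdiff, i₁, Finset.mem_insert, not_or]
      rcases hx with rfl | rfl
      · exact ⟨b₂ hm₂, k12.symm, m₂⟩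
      · exact ⟨b₃ hm₃, k13.symm, m₃⟩
    · intro x hx
      simp only [Finset.mem_insert, Finset.mem_singleton] at hx
      rw [Finset.mem_sdiff, i₂, Finset.mem_insert, not_or]
      rcases hx with rfl | rfl
      · exact ⟨b₁ hm₁, k12, m₁⟩
      · exact ⟨b₃ hm₃, k23.symm, m₃⟩
    · intro x hx
      simp only [Finset.mem_insert, Finset.mem_singleton] at hx
      rw [Finset.mem_sdiff, i₃, Finset.mem_insert, not_or]
      rcases hx with rfl | rfl
      · exact ⟨b₁ hm₁, k13, m₁⟩
      · exact ⟨b₂ hm₂, k23, m₂⟩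
  have h2 : X.card ≤ ((X.image fun x => x.1) ×ˢ (Finset.univ : Finset Bool)).card := by
    refine Finset.card_le_card_of_injOn (fun x => (x.1, x.2.1)) ?_ ?_
    · intro x hx
      simp only [Finset.coe_product, Set.mem_prod, Finset.mem_coe]
      exact ⟨Finset.mem_image_of_mem _ hx, Finset.mem_univ _⟩
    · rintro ⟨Q, s, B₁, I₁⟩ hx ⟨Q', s', B₂, I₂⟩ hx' heq
      obtain ⟨rfl, rfl, -⟩ := hXm _ _ _ _ hx
      obtain ⟨rfl, rfl, -⟩ := hXm _ _ _ _ hx'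
      simp only [Prod.mk.injEq] at heq ⊢
      tauto
  rw [Finset.card_product, Finset.card_univ, Fintype.card_bool] at h2
  omega

theorem edgeFlags_recurrence (hv : SpansKernels ℓ v)
    (h𝓘 : ∀ R, ∀ I ∈ 𝓘 R, ∀ h ∈ R, I.erase h ∈ 𝓘 (R.erase h)) (R : Finset ι) {j : ℕ}
    (hj : j ≤ 3) :
    (R.card - 3) * (edgeFlags ℓ 𝓘 R j).card ≤
      (∑ h ∈ R, (edgeFlags ℓ 𝓘 (R.erase h) j).card) + 4 * (vertexFlags ℓ v 𝓘 R (j + 1)).card := by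
  classical
  set P := (edgeFlags ℓ 𝓘 R j).sigma fun x => R \ x.1 with hP
  have hPc : P.card = (R.card - 3) * (edgeFlags ℓ 𝓘 R j).card := by
    rw [hP, Finset.card_sigma, Finset.sum_congr rfl (g := fun _ => R.card - 3), Finset.sum_const,
      smul_eq_mul, mul_comm]
    rintro ⟨F, B, I⟩ hx
    rw [mem_edgeFlags] at hx
    simp only
    rw [Finset.card_sdiff_of_subset hx.1.1, hx.1.2]
  set T := R.sigma fun h => edgeFlags ℓ 𝓘 (R.erase h) j with hT
  have hTc : T.card = ∑ h ∈ R, (edgeFlags ℓ 𝓘 (R.erase h) j).card := Finset.card_sigma _ _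
  let Φ : (Σ _ : Finset ι × Finset ι × Finset ι, ι) → Σ _ : ι, Finset ι × Finset ι × Finset ι :=
    fun y => ⟨y.2, (y.1.1, y.1.2.1, y.1.2.2.erase y.2)⟩
  set P1 := P.filter fun y => y.2 ∈ y.1.2.2 with hP1
  set P0 := P.filter fun y => y.2 ∉ y.1.2.2 with hP0
  have hsum : P1.card + P0.card = P.card := Finset.card_filter_add_card_filter_not _
  have i1 : (P1.image Φ).card = P1.card := by
    refine Finset.card_image_of_injOn ?_
    rintro ⟨⟨F, B, I⟩, h⟩ hx ⟨⟨F', B', I'⟩, h'⟩ hx' heq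
    have m1 := (Finset.mem_filter.1 hx).2
    have m2 := (Finset.mem_filter.1 hx').2
    simp only [Φ, Sigma.mk.injEq, heq_eq_eq, Prod.mk.injEq] at heq m1 m2 ⊢
    obtain ⟨rfl, rfl, rfl, h4⟩ := heq
    refine ⟨⟨rfl, rfl, ?_⟩, rfl⟩
    rw [← Finset.insert_erase m1, h4, Finset.insert_erase m2]
  have i0 : (P0.image Φ).card = P0.card := by
    refine Finset.card_image_of_injOn ?_
    rintro ⟨⟨F, B, I⟩, h⟩ hx ⟨⟨F', B', I'⟩, h'⟩ hx' heq
    have m1 := (Finset.mem_filter.1 hx).2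
    have m2 := (Finset.mem_filter.1 hx').2
    simp only [Φ, Sigma.mk.injEq, heq_eq_eq, Prod.mk.injEq] at heq m1 m2 ⊢
    obtain ⟨rfl, rfl, rfl, h4⟩ := heq
    refine ⟨⟨rfl, rfl, ?_⟩, rfl⟩
    rwa [Finset.erase_eq_of_notMem m1, Finset.erase_eq_of_notMem m2] at h4
  have hun := Finset.card_union_add_card_inter (P1.image Φ) (P0.image Φ)
  have hPT : ∀ y ∈ P, Φ y ∈ T := by
    rintro ⟨⟨F, B, I⟩, h⟩ hy
    obtain ⟨hx, hh⟩ := Finset.mem_sigma.1 hy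
    obtain ⟨hhR, hhF⟩ := Finset.mem_sdiff.1 hh
    rw [mem_edgeFlags] at hx
    obtain ⟨⟨hFR, hF⟩, ⟨hBF, hB⟩, hIR, hd, hB', X, hX0, hX⟩ := hx
    refine Finset.mem_sigma.2 ⟨hhR, mem_edgeFlags.2 ⟨⟨?_, hF⟩, ⟨hBF, hB⟩, ?_, ?_, ?_, X, hX0, ?_⟩⟩
    · intro i hi
      refine Finset.mem_erase.2 ⟨?_, hFR hi⟩
      rintro rfl
      exact hhF hi
    · exact Finset.erase_subset_erase _ hIR
    · exact hd.mono_left (Finset.erase_subset _ _)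
    · intro B'' hB''
      have := h𝓘 R _ (hB' B'' hB'') h hhR
      rwa [Finset.erase_union_distrib, Finset.erase_eq_of_notMem (a := h) (s := B'')] at this
      exact fun e => hhF (hBF (hB'' e))
    · intro c hc
      simp only [Φ, Finset.mem_sdiff, Finset.mem_erase] at hc ⊢
      have := hX c (Finset.mem_sdiff.2 ⟨hc.1.2, hc.2⟩)
      simpa [hc.1.1] using this
  have hsubT : P1.image Φ ∪ P0.image Φ ⊆ T := by
    intro z hz
    rcases Finset.mem_union.1 hz with hz | hz
    all_goals
      obtain ⟨y, hy, rfl⟩ := Finset.mem_image.1 hz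
      exact hPT y (Finset.mem_of_mem_filter y hy)
  have hinter : P1.image Φ ∩ P0.image Φ ⊆ (vertexFlags ℓ v 𝓘 R (j + 1)).biUnion fun x =>
      x.2.2.1.image fun h => ⟨h, (x.1.erase h, x.2.2.1.erase h, x.2.2.2)⟩ := by
    intro z hz
    obtain ⟨hz1, hz0⟩ := Finset.mem_inter.1 hz
    obtain ⟨⟨⟨F, B, I⟩, h⟩, hy1, rfl⟩ := Finset.mem_image.1 hz1
    obtain ⟨⟨⟨F', B', I₀⟩, h'⟩, hy0, heq⟩ := Finset.mem_image.1 hz0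
    obtain ⟨hy1, hm1⟩ := Finset.mem_filter.1 hy1
    obtain ⟨hy0, hm0⟩ := Finset.mem_filter.1 hy0
    simp only [Φ, Sigma.mk.injEq, heq_eq_eq, Prod.mk.injEq] at heq hm1 hm0
    obtain ⟨rfl, rfl, rfl, h4⟩ := heq
    rw [Finset.erase_eq_of_notMem hm0] at h4
    obtain rfl : I = insert h' I₀ := by rw [h4, Finset.insert_erase hm1]
    obtain ⟨hx1, hh⟩ := Finset.mem_sigma.1 hy1
    obtain ⟨hhR, hhF⟩ := Finset.mem_sdiff.1 hh
    obtain ⟨hx0, -⟩ := Finset.mem_sigma.1 hy0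
    rw [mem_edgeFlags] at hx1 hx0
    obtain ⟨-, -, -, -, hB1, X1, hX1, hM1⟩ := hx1
    obtain ⟨⟨hFR, hF⟩, ⟨hBF, hB⟩, hIR, hd, hB0, X0, hX0, hM0⟩ := hx0
    simp only at hhR hhF
    have a0 : 0 < ℓ h' X0 := (hM0 h' hh).2 hm0
    have a1 : ℓ h' X1 < 0 := (hM1 h' hh).1 (by simp)
    set Y := (-(ℓ h' X1)) • X0 + (ℓ h' X0) • X1 with hY
    have hQ : (insert h' F').card = 4 := by rw [Finset.card_insert_of_notMem hhF, hF]
    have hY0 : ∀ i ∈ insert h' F', ℓ i Y = 0 := by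
      intro i hi
      rcases Finset.mem_insert.1 hi with rfl | hi
      · simp only [hY, map_add, map_smul, smul_eq_mul]; ring
      · simp [hY, hX0 i hi, hX1 i hi]
    have hYM : MatchesOn ℓ I₀ (R \ insert h' F') Y := by
      intro c hc
      simp only [Finset.mem_sdiff, Finset.mem_insert, not_or] at hc
      have b0 := hM0 c (Finset.mem_sdiff.2 ⟨hc.1, hc.2.2⟩)
      have b1 := hM1 c (Finset.mem_sdiff.2 ⟨hc.1, hc.2.2⟩)
      simp only [Finset.mem_insert, hc.2.1, false_or] at b1
      simp only [hY, map_add, map_smul, smul_eq_mul]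
      constructor
      · intro hi
        nlinarith [mul_pos (neg_pos.2 a1) (neg_pos.2 (b0.1 hi)), mul_pos a0 (neg_pos.2 (b1.1 hi))]
      · intro hi
        nlinarith [mul_pos (neg_pos.2 a1) (b0.2 hi), mul_pos a0 (b1.2 hi)]
    obtain ⟨s, hs⟩ : ∃ s, MatchesOn ℓ I₀ (R \ insert h' F') (signedRay v (insert h' F') s) := by
      by_cases hYz : Y = 0
      · refine ⟨true, fun c hc => ?_⟩
        have := hYM c hc
        rw [hYz, map_zero] at this
        exact absurd this (by simp)
      · obtain ⟨s, t, ht, hst⟩ := hv.exists_signedRay hQ hYz hY0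
        exact ⟨s, MatchesOn.of_smul ht (hst ▸ hYM)⟩
    refine Finset.mem_biUnion.2 ⟨(insert h' F', s, insert h' B', I₀), mem_vertexFlags.2
      ⟨⟨Finset.insert_subset hhR hFR, hQ⟩, ⟨Finset.insert_subset_insert _ hBF, ?_⟩, hIR, ?_, ?_,
        hs⟩, Finset.mem_image.2 ⟨h', by simp, ?_⟩⟩
    · rw [Finset.card_insert_of_notMem fun e => hhF (hBF e), hB]
    · rw [Finset.disjoint_insert_right]; exact ⟨hm0, hd⟩
    · intro B'' hB''
      by_cases hh' : h' ∈ B''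
      · have := hB1 (B''.erase h') (by rwa [← Finset.subset_insert_iff])
        rwa [Finset.insert_union, ← Finset.union_insert, Finset.insert_erase hh'] at this
      · exact hB0 B'' ((Finset.subset_insert_iff_of_notMem hh').1 hB'')
    · simp only [Φ]
      rw [Finset.erase_insert hhF, Finset.erase_insert fun e => hhF (hBF e),
        Finset.erase_insert hm0]
  have hinter' := Finset.card_le_card hinter
  have hbi := Finset.card_biUnion_le_card_mul (vertexFlags ℓ v 𝓘 R (j + 1))
    (fun x => x.2.2.1.image fun h => (⟨h, (x.1.erase h, x.2.2.1.erase h, x.2.2.2)⟩ :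
      Σ _ : ι, Finset ι × Finset ι × Finset ι)) 4 (by
      rintro ⟨Q, s, B, I⟩ hx
      rw [mem_vertexFlags] at hx
      exact Finset.card_image_le.trans (by simp only; omega))
  have := Finset.card_le_card hsubT
  omega

theorem card_vertexFlags_step [Fintype ι] (hι : 5 ≤ Fintype.card ι) (hℓ : InGeneralPosition ℓ)
    (hv : SpansKernels ℓ v) (h𝓘 : ∀ R, ∀ I ∈ 𝓘 R, ∀ h ∈ R, I.erase h ∈ 𝓘 (R.erase h))
    {A lam : ℝ} (hA : 3 ≤ A) (hlam : 1 + (harmonic (Fintype.card ι) : ℝ) ≤ lam) {j : ℕ}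
    (hj : j ≤ 3)
    (hX : ∀ R : Finset ι, 4 ≤ R.card →
      ((vertexFlags ℓ v 𝓘 R (j + 1)).card : ℝ) ≤ A * (R.card.descFactorial 3 : ℝ))
    (R : Finset ι) (hR : 4 ≤ R.card) :
    ((vertexFlags ℓ v 𝓘 R j).card : ℝ) ≤ 16 * lam * A * (R.card.descFactorial 3 : ℝ) := by
  have h1 := le_of_deletion_recurrence (fun R => ((edgeFlags ℓ 𝓘 R j).card : ℝ)) (4 * A) lam
    (Fintype.card ι) (by linarith) hlam ?_ ?_ R (by omega) (Finset.card_le_univ R)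
  · have h2 : ((vertexFlags ℓ v 𝓘 R j).card : ℝ) ≤ 4 * ((edgeFlags ℓ 𝓘 R j).card : ℝ) := by
      exact_mod_cast card_vertexFlags_le hι hℓ hv R hj
    nlinarith
  · intro R hR
    have : ((edgeFlags ℓ 𝓘 R j).card : ℝ) ≤ 64 := by
      exact_mod_cast card_edgeFlags_le_of_card_eq_three hR j
    linarith
  · intro R hR _
    have h := edgeFlags_recurrence hv h𝓘 R hj
    have h' : ((R.card - 3 : ℕ) : ℝ) * ((edgeFlags ℓ 𝓘 R j).card : ℝ) ≤
        (∑ h ∈ R, ((edgeFlags ℓ 𝓘 (R.erase h) j).card : ℝ)) +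
          4 * ((vertexFlags ℓ v 𝓘 R (j + 1)).card : ℝ) := by exact_mod_cast h
    rw [Nat.cast_sub (by omega)] at h'
    have := hX R hR
    push_cast at h'
    nlinarith

/-- The number of vertex–cell incidences of an arrangement is at most the maximal number of
cells, up to logarithmic factors. -/
theorem card_vertexFlags_zero_le [Fintype ι] (hι : 5 ≤ Fintype.card ι)
    (hℓ : InGeneralPosition ℓ) (hv : SpansKernels ℓ v) (hsub : ∀ R, ∀ I ∈ 𝓘 R, I ⊆ R)
    (h𝓘 : ∀ R, ∀ I ∈ 𝓘 R, ∀ h ∈ R, I.erase h ∈ 𝓘 (R.erase h))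
    {M lam : ℝ} (hM : 2 ≤ M) (hlam : 1 + (harmonic (Fintype.card ι) : ℝ) ≤ lam)
    (hcell : ∀ R : Finset ι, 4 ≤ R.card →
      ((𝓘 R).card : ℝ) ≤ M * (R.card.descFactorial 3 : ℝ))
    (R : Finset ι) (hR : 4 ≤ R.card) :
    ((vertexFlags ℓ v 𝓘 R 0).card : ℝ) ≤
      2 * 16 ^ 4 * M * lam ^ 4 * (R.card.descFactorial 3 : ℝ) := by
  have hlam1 : 1 ≤ lam := by
    have : (0 : ℝ) ≤ harmonic (Fintype.card ι) := by
      have : (0 : ℚ) ≤ harmonic (Fintype.card ι) :=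
        Finset.sum_nonneg fun i _ => by positivity
      exact_mod_cast this
    linarith
  have h4 : ∀ R : Finset ι, 4 ≤ R.card → ((vertexFlags ℓ v 𝓘 R (3 + 1)).card : ℝ) ≤
      (2 * M) * (R.card.descFactorial 3 : ℝ) := by
    intro R hR
    have h1 : ((vertexFlags ℓ v 𝓘 R 4).card : ℝ) ≤ 2 * ((𝓘 R).card : ℝ) := by
      exact_mod_cast card_vertexFlags_four_le hsub R
    have := hcell R hR
    simp only [Nat.reduceAdd]
    linarith
  have grow : ∀ {A : ℝ}, 3 ≤ A → 3 ≤ 16 * lam * A := fun {A} hA => by nlinarith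
  have a4 : (3 : ℝ) ≤ 2 * M := by linarith
  have h3 := card_vertexFlags_step hι hℓ hv h𝓘 a4 hlam (j := 3) le_rfl h4
  have h2 := card_vertexFlags_step hι hℓ hv h𝓘 (grow a4) hlam (j := 2) (by norm_num) h3
  have h1 := card_vertexFlags_step hι hℓ hv h𝓘 (grow (grow a4)) hlam (j := 1) (by norm_num) h2
  have h0 := card_vertexFlags_step hι hℓ hv h𝓘 (grow (grow (grow a4))) hlam (j := 0)
    (by norm_num) h1 R hR
  refine h0.trans (le_of_eq ?_)
  ring

/-- The closed cone cut out by the sign pattern `I` on `R`. -/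
def InClosedCell (ℓ : ι → W →ₗ[ℝ] ℝ) (I R : Finset ι) (X : W) : Prop :=
  ∀ c ∈ R, (c ∈ I → ℓ c X ≤ 0) ∧ (c ∉ I → 0 ≤ ℓ c X)

/-- The cone spanned by five signed rays. -/
def simplicialCone (v : Finset ι → W) (U : Fin 5 → Finset ι × Bool) : Set W :=
  {X | ∃ a : Fin 5 → ℝ, (∀ i, 0 ≤ a i) ∧ X = ∑ i, a i • signedRay v (U i).1 (U i).2}

theorem InClosedCell.eq_zero (hℓ : InGeneralPosition ℓ) {I R : Finset ι} (hR : 5 ≤ R.card)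
    {X : W} (hX : InClosedCell ℓ I R X) (hX' : InClosedCell ℓ I R (-X)) : X = 0 := by
  obtain ⟨Q, hQR, hQ⟩ := Finset.exists_subset_card_eq hR
  refine hℓ Q hQ X fun i hi => ?_
  have h1 := hX i (hQR hi)
  have h2 := hX' i (hQR hi)
  rw [map_neg] at h2
  by_cases h : i ∈ I
  · linarith [h1.1 h, h2.1 h]
  · linarith [h1.2 h, h2.2 h]

theorem InClosedCell.sum_smul {κ : Type*} (s : Finset κ) {I R : Finset ι} {u : κ → W} {a : κ → ℝ}
    (ha : ∀ i ∈ s, 0 ≤ a i) (hu : ∀ i ∈ s, InClosedCell ℓ I R (u i)) :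
    InClosedCell ℓ I R (∑ i ∈ s, a i • u i) := by
  intro c hc
  simp only [map_sum, map_smul, smul_eq_mul]
  exact ⟨fun h => Finset.sum_nonpos fun i hi =>
      mul_nonpos_of_nonneg_of_nonpos (ha i hi) ((hu i hi c hc).1 h),
    fun h => Finset.sum_nonneg fun i hi => mul_nonneg (ha i hi) ((hu i hi c hc).2 h)⟩

/-- Moving in the direction `-w` inside the face `ker F` of a closed cell until a new
functional vanishes. -/
theorem InClosedCell.exists_hit {I R F : Finset ι} {p w : W}
    (hp : InClosedCell ℓ I R p) (hpF : ∀ i ∈ F, ℓ i p = 0) (hw : ∀ i ∈ F, ℓ i w = 0)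
    (hpos : ∃ c ∈ R, (c ∈ I ∧ ℓ c w < 0) ∨ (c ∉ I ∧ 0 < ℓ c w)) :
    ∃ h ∈ R, h ∉ F ∧ ∃ s : ℝ, 0 ≤ s ∧ InClosedCell ℓ I R (p - s • w) ∧
      ∀ i ∈ insert h F, ℓ i (p - s • w) = 0 := by
  classical
  set T := R.filter fun c => (c ∈ I ∧ ℓ c w < 0) ∨ (c ∉ I ∧ 0 < ℓ c w) with hT
  have hTne : T.Nonempty := by
    obtain ⟨c, hc, h⟩ := hpos
    exact ⟨c, Finset.mem_filter.2 ⟨hc, h⟩⟩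
  obtain ⟨h, hhT, hmin⟩ := Finset.exists_min_image T (fun c => ℓ c p / ℓ c w) hTne
  obtain ⟨hhR, hh⟩ := Finset.mem_filter.1 hhT
  have hne : ℓ h w ≠ 0 := by rcases hh with h | h; exacts [h.2.ne, h.2.ne']
  refine ⟨h, hhR, fun hF => hne (hw h hF), ℓ h p / ℓ h w, ?_, ?_, ?_⟩
  · rcases hh with hh | hh
    · exact div_nonneg_of_nonpos ((hp h hhR).1 hh.1) hh.2.le
    · exact div_nonneg ((hp h hhR).2 hh.1) hh.2.le
  · set s := ℓ h p / ℓ h w with hs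
    have hs0 : 0 ≤ s := by
      rcases hh with hh | hh
      · exact div_nonneg_of_nonpos ((hp h hhR).1 hh.1) hh.2.le
      · exact div_nonneg ((hp h hhR).2 hh.1) hh.2.le
    intro c hc
    simp only [map_sub, map_smul, smul_eq_mul]
    constructor
    · intro hi
      have h1 := (hp c hc).1 hi
      by_cases hcw : ℓ c w < 0
      · have := hmin c (Finset.mem_filter.2 ⟨hc, Or.inl ⟨hi, hcw⟩⟩)
        rw [le_div_iff_of_neg hcw] at this
        linarith
      · nlinarith [mul_nonneg hs0 (not_lt.1 hcw)]
    · intro hi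
      have h1 := (hp c hc).2 hi
      by_cases hcw : 0 < ℓ c w
      · have := hmin c (Finset.mem_filter.2 ⟨hc, Or.inr ⟨hi, hcw⟩⟩)
        rw [le_div_iff₀ hcw] at this
        linarith
      · nlinarith [mul_nonneg hs0 (neg_nonneg.2 (not_lt.1 hcw))]
  · intro i hi
    rcases Finset.mem_insert.1 hi with rfl | hi
    · simp only [map_sub, map_smul, smul_eq_mul]
      field_simp
      ring
    · simp [hpF i hi, hw i hi]

/-- A nonzero face of a closed cell contains a signed ray. -/
theorem InClosedCell.exists_vertex [FiniteDimensional ℝ W] (hW : Module.finrank ℝ W = 5)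
    (hℓ : InGeneralPosition ℓ) (hv : SpansKernels ℓ v) {I R : Finset ι} (hR : 5 ≤ R.card)
    (F : Finset ι) (hFR : F ⊆ R) (hF : F.card ≤ 4) {X : W} (hX0 : X ≠ 0)
    (hX : InClosedCell ℓ I R X) (hXF : ∀ i ∈ F, ℓ i X = 0) :
    ∃ y : Finset ι × Bool, F ⊆ y.1 ∧ y.1 ⊆ R ∧ y.1.card = 4 ∧
      InClosedCell ℓ I R (signedRay v y.1 y.2) := by
  induction hk : 4 - F.card generalizing F X with
  | zero =>
    have hF4 : F.card = 4 := by omega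
    obtain ⟨s, t, ht, rfl⟩ := hv.exists_signedRay hF4 hX0 hXF
    refine ⟨(F, s), subset_rfl, hFR, hF4, fun c hc => ?_⟩
    have := hX c hc
    simp only [map_smul, smul_eq_mul] at this
    exact ⟨fun h => nonpos_of_mul_nonpos_right (this.1 h) ht,
      fun h => nonneg_of_mul_nonneg_right (this.2 h) ht⟩
  | succ k ih =>
    suffices h : ∃ h ∈ R, h ∉ F ∧ ∃ Y : W, Y ≠ 0 ∧ InClosedCell ℓ I R Y ∧
        ∀ i ∈ insert h F, ℓ i Y = 0 by
      obtain ⟨h, hhR, hhF, Y, hY0, hY, hYF⟩ := h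
      have hc := Finset.card_insert_of_notMem hhF
      obtain ⟨y, hy, hy'⟩ := ih (insert h F) (Finset.insert_subset hhR hFR) (by omega) hY0 hY hYF
        (by omega)
      exact ⟨y, (Finset.subset_insert _ _).trans hy, hy'⟩
    obtain ⟨h', hh'R, hh'F⟩ : ∃ h' ∈ R, h' ∉ F := by
      by_contra! hall
      have := Finset.card_le_card hall
      omega
    by_cases hz : ℓ h' X = 0
    · refine ⟨h', hh'R, hh'F, X, hX0, hX, fun i hi => ?_⟩
      rcases Finset.mem_insert.1 hi with rfl | hi
      exacts [hz, hXF i hi]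
    · obtain ⟨w, hw0, hw⟩ := exists_ne_zero_kernel hW ℓ (insert h' F)
        ((Finset.card_insert_le _ _).trans (by omega))
      have hpos : ∃ t : ℝ, ∃ c ∈ R, (c ∈ I ∧ ℓ c (t • w) < 0) ∨ (c ∉ I ∧ 0 < ℓ c (t • w)) := by
        have : ¬ (InClosedCell ℓ I R w ∧ InClosedCell ℓ I R (-w)) := fun h =>
          hw0 (h.1.eq_zero hℓ hR h.2)
        by_contra! hcon
        refine this ⟨fun c hc => ⟨fun hi => ?_, fun hi => ?_⟩,
          fun c hc => ⟨fun hi => ?_, fun hi => ?_⟩⟩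
        · have := (hcon (-1) c hc).1 hi; simp at this; linarith
        · have := (hcon (-1) c hc).2 hi; simp at this; linarith
        · have := (hcon 1 c hc).1 hi; simp at this ⊢; linarith
        · have := (hcon 1 c hc).2 hi; simp at this ⊢; linarith
      obtain ⟨t, hpos⟩ := hpos
      obtain ⟨h, hhR, hhF, s, -, hs, hs'⟩ := hX.exists_hit hXF (w := t • w)
        (fun i hi => by rw [map_smul, hw i (Finset.mem_insert_of_mem hi), smul_zero]) hpos
      refine ⟨h, hhR, hhF, _, fun h0 => hz ?_, hs, hs'⟩
      rw [sub_eq_zero.1 h0, map_smul, map_smul, hw h' (Finset.mem_insert_self _ _)]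
      simp

theorem InClosedCell.exists_step (hℓ : InGeneralPosition ℓ) (hv : SpansKernels ℓ v)
    {I R : Finset ι} (hR : 5 ≤ R.card)
    {F : Finset ι} (hF : F.card ≤ 3) {p : W}
    (hp : InClosedCell ℓ I R p) (hpF : ∀ i ∈ F, ℓ i p = 0) {y : Finset ι × Bool}
    (hy1 : F ⊆ y.1) (hy2 : y.1 ⊆ R) (hy3 : y.1.card = 4)
    (hy4 : InClosedCell ℓ I R (signedRay v y.1 y.2)) :
    ∃ h ∈ R, h ∉ F ∧ ∃ (s : ℝ) (p' : W), 0 ≤ s ∧ p = s • signedRay v y.1 y.2 + p' ∧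
      InClosedCell ℓ I R p' ∧ (∀ i ∈ insert h F, ℓ i p' = 0) ∧
      ∃ X : W, X ≠ 0 ∧ InClosedCell ℓ I R X ∧ ∀ i ∈ insert h F, ℓ i X = 0 := by
  set u := signedRay v y.1 y.2 with hu
  have hu0 : u ≠ 0 := hv.signedRay_ne_zero hy3 y.2
  have huy : ∀ i ∈ y.1, ℓ i u = 0 := fun i hi => hv.apply_signedRay hy3 y.2 hi
  obtain ⟨h, hhR, hhF, s, hs0, hs, hs'⟩ := hp.exists_hit hpF (w := u)
    (fun i hi => huy i (hy1 hi)) (by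
      by_contra! hcon
      refine hu0 (hy4.eq_zero hℓ hR fun c hc => ⟨fun hi => ?_, fun hi => ?_⟩)
      · rw [map_neg]; linarith [(hcon c hc).1 hi]
      · rw [map_neg]; linarith [(hcon c hc).2 hi])
  by_cases h0 : p - s • u = 0
  · obtain ⟨h', hh'y, hh'F⟩ : ∃ h' ∈ y.1, h' ∉ F := by
      by_contra! hall
      have := Finset.card_le_card hall
      omega
    refine ⟨h', hy2 hh'y, hh'F, s, 0, hs0, by rw [add_zero]; exact sub_eq_zero.1 h0,
      h0 ▸ hs, by simp, u, hu0, hy4, fun i hi => huy i ?_⟩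
    exact Finset.insert_subset hh'y hy1 hi
  · exact ⟨h, hhR, hhF, s, p - s • u, hs0, by abel, hs, hs', _, h0, hs, hs'⟩

/-- The closed cells of an arrangement are covered by few simplicial cones, none of which is
crossed by the arrangement. -/
theorem exists_simplicialCone_cover [FiniteDimensional ℝ W] (hW : Module.finrank ℝ W = 5)
    (hℓ : InGeneralPosition ℓ) (hv : SpansKernels ℓ v) {R : Finset ι} (hR : 5 ≤ R.card) :
    ∃ 𝒢 : Finset (Fin 5 → Finset ι × Bool),
      𝒢.card ≤ 256 * (vertexFlags ℓ v 𝓘 R 0).card ∧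
      (∀ U ∈ 𝒢, (∀ i, (U i).1.card = 4) ∧
        ∀ c ∈ R, (∀ X ∈ simplicialCone v U, ℓ c X ≤ 0) ∨
          (∀ X ∈ simplicialCone v U, 0 ≤ ℓ c X)) ∧
      ∀ I ∈ 𝓘 R, I ⊆ R → ∀ X : W, X ≠ 0 → InClosedCell ℓ I R X →
        ∃ U ∈ 𝒢, X ∈ simplicialCone v U := by
  classical
  have hex : ∀ I F : Finset ι, ∃ y : Finset ι × Bool, F ⊆ R → F.card ≤ 4 →
      (∃ X : W, X ≠ 0 ∧ InClosedCell ℓ I R X ∧ ∀ i ∈ F, ℓ i X = 0) →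
      F ⊆ y.1 ∧ y.1 ⊆ R ∧ y.1.card = 4 ∧ InClosedCell ℓ I R (signedRay v y.1 y.2) := by
    intro I F
    by_cases h : F ⊆ R ∧ F.card ≤ 4 ∧
        ∃ X : W, X ≠ 0 ∧ InClosedCell ℓ I R X ∧ ∀ i ∈ F, ℓ i X = 0
    · obtain ⟨h1, h2, X, h3, h4, h5⟩ := h
      obtain ⟨y, hy⟩ := InClosedCell.exists_vertex hW hℓ hv hR F h1 h2 h3 h4 h5
      exact ⟨y, fun _ _ _ => hy⟩
    · exact ⟨(∅, true), fun a b c => absurd ⟨a, b, c⟩ h⟩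
  choose u hu using hex
  let gen : Finset ι → ι × ι × ι × ι → Fin 5 → Finset ι × Bool := fun I x =>
    ![u I ∅, u I {x.1}, u I {x.2.1, x.1}, u I {x.2.2.1, x.2.1, x.1},
      u I {x.2.2.2, x.2.2.1, x.2.1, x.1}]
  set 𝒢₀ := (vertexFlags ℓ v 𝓘 R 0).biUnion fun x =>
    (x.1 ×ˢ x.1 ×ˢ x.1 ×ˢ x.1).image (gen x.2.2.2) with h𝒢₀
  refine ⟨𝒢₀.filter fun U => (∀ i, (U i).1.card = 4) ∧
        ∀ c ∈ R, (∀ X ∈ simplicialCone v U, ℓ c X ≤ 0) ∨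
          (∀ X ∈ simplicialCone v U, 0 ≤ ℓ c X), ?_, fun U hU => (Finset.mem_filter.1 hU).2, ?_⟩
  · refine (Finset.card_filter_le _ _).trans ?_
    rw [mul_comm]
    refine Finset.card_biUnion_le_card_mul _ _ _ ?_
    rintro ⟨Q, s, B, I⟩ hx
    rw [mem_vertexFlags] at hx
    refine Finset.card_image_le.trans ?_
    simp only [Finset.card_product, hx.1.2]
    norm_num
  · intro I hI hIR X hX0 hX
    obtain ⟨p1, p2, p3, p4⟩ := hu I ∅ (by simp) (by simp) ⟨X, hX0, hX, by simp⟩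
    obtain ⟨a, haR, -, s₀, X₁, hs₀, e₀, hX₁, hz₁, hn₁⟩ :=
      hX.exists_step hℓ hv hR (F := ∅) (by simp) (by simp) p1 p2 p3 p4
    have c₁ : (insert a ∅ : Finset ι).card = 1 := by simp
    have r₁ : (insert a ∅ : Finset ι) ⊆ R := by simpa using haR
    obtain ⟨p5, p6, p7, p8⟩ := hu I (insert a ∅) r₁ (by omega) hn₁
    obtain ⟨b, hbR, hb, s₁, X₂, hs₁, e₁, hX₂, hz₂, hn₂⟩ :=
      hX₁.exists_step hℓ hv hR (by omega) hz₁ p5 p6 p7 p8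
    have c₂ := Finset.card_insert_of_notMem hb
    have r₂ := Finset.insert_subset hbR r₁
    obtain ⟨p9, p10, p11, p12⟩ := hu I _ r₂ (by omega) hn₂
    obtain ⟨c, hcR, hc, s₂, X₃, hs₂, e₂, hX₃, hz₃, hn₃⟩ :=
      hX₂.exists_step hℓ hv hR (by omega) hz₂ p9 p10 p11 p12
    have c₃ := Finset.card_insert_of_notMem hc
    have r₃ := Finset.insert_subset hcR r₂
    obtain ⟨p13, p14, p15, p16⟩ := hu I _ r₃ (by omega) hn₃
    obtain ⟨d, hdR, hd, s₃, X₄, hs₃, e₃, hX₄, hz₄, hn₄⟩ :=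
      hX₃.exists_step hℓ hv hR (by omega) hz₃ p13 p14 p15 p16
    have c₄ := Finset.card_insert_of_notMem hd
    have r₄ := Finset.insert_subset hdR r₃
    obtain ⟨p17, p18, p19, p20⟩ := hu I _ r₄ (by omega) hn₄
    set Q : Finset ι := insert d (insert c (insert b (insert a ∅))) with hQ
    have hQ4 : Q.card = 4 := by omega
    have hQu : Q = (u I Q).1 := Finset.eq_of_subset_of_card_le p17 (by omega)
    set ray := signedRay v (u I Q).1 (u I Q).2 with hray
    have hray0 : ray ≠ 0 := hv.signedRay_ne_zero p19 _
    have hrayQ : ∀ i ∈ Q, ℓ i ray = 0 := fun i hi => hv.apply_signedRay p19 _ (p17 hi)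
    obtain ⟨s₄, hs₄, e₄⟩ : ∃ s₄ : ℝ, 0 ≤ s₄ ∧ X₄ = s₄ • ray := by
      by_cases h0 : X₄ = 0
      · exact ⟨0, le_rfl, by simp [h0]⟩
      obtain ⟨s', t, ht, h⟩ := hv.exists_signedRay hQ4 h0 hz₄
      by_cases hs' : s' = (u I Q).2
      · exact ⟨t, ht.le, by rw [h, hray, ← hQu, hs']⟩
      · exfalso
        have hneg : signedRay v Q s' = -ray := by
          rw [hray, ← hQu]
          unfold signedRay
          revert hs'
          cases s' <;> cases (u I Q).2 <;> simp
        refine hray0 (p20.eq_zero hℓ hR fun i hi => ?_)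
        have := hX₄ i hi
        rw [h, hneg, map_smul, smul_eq_mul] at this
        exact ⟨fun h => nonpos_of_mul_nonpos_right (this.1 h) ht,
          fun h => nonneg_of_mul_nonneg_right (this.2 h) ht⟩
    have hflag : (Q, (u I Q).2, (∅ : Finset ι), I) ∈ vertexFlags ℓ v 𝓘 R 0 := by
      refine mem_vertexFlags.2 ⟨⟨r₄, hQ4⟩, by simp, hIR, by simp, ?_, fun i hi => ?_⟩
      · intro B' hB'
        rw [Finset.subset_empty.1 hB', Finset.union_empty]
        exact hI
      · obtain ⟨hiR, hiQ⟩ := Finset.mem_sdiff.1 hi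
        have hne := hℓ.ne_zero hQ4 hray0 hrayQ hiQ
        have := p20 i hiR
        rw [show signedRay v Q (u I Q).2 = ray by rw [hray, ← hQu]]
        exact ⟨fun h => lt_of_le_of_ne (this.1 h) hne, fun h => lt_of_le_of_ne (this.2 h) hne.symm⟩
    have hcells : ∀ i, InClosedCell ℓ I R
        (signedRay v (gen I (a, b, c, d) i).1 (gen I (a, b, c, d) i).2) := by
      intro i
      fin_cases i
      exacts [p4, p8, p12, p16, p20]
    refine ⟨gen I (a, b, c, d), Finset.mem_filter.2 ⟨Finset.mem_biUnion.2 ⟨_, hflag,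
      Finset.mem_image.2 ⟨(a, b, c, d), ?_, rfl⟩⟩, ?_, ?_⟩, ![s₀, s₁, s₂, s₃, s₄], ?_, ?_⟩
    · simp [hQ]
    · intro i
      fin_cases i
      exacts [p3, p7, p11, p15, p19]
    · intro i hi
      by_cases hiI : i ∈ I
      · left
        rintro Y ⟨t, ht, rfl⟩
        exact (InClosedCell.sum_smul Finset.univ (fun i _ => ht i) (fun i _ => hcells i) i hi).1 hiI
      · right
        rintro Y ⟨t, ht, rfl⟩
        exact (InClosedCell.sum_smul Finset.univ (fun i _ => ht i) (fun i _ => hcells i) i hi).2 hiI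
    · intro i
      fin_cases i
      exacts [hs₀, hs₁, hs₂, hs₃, hs₄]
    · rw [Fin.sum_univ_five, e₀, e₁, e₂, e₃, e₄]
      change _ = s₀ • _ + s₁ • _ + s₂ • _ + s₃ • _ + s₄ • ray
      simp only [add_assoc]
      rfl

end

/-- The functional on `ℝ⁵` whose restriction to the paraboloid is a monic sphere equation. -/
def sphereFunctional (k : Fin 4 → ℝ) : (Fin 5 → ℝ) →ₗ[ℝ] ℝ :=
  k 0 • LinearMap.proj 0 + k 1 • LinearMap.proj 1 + k 2 • LinearMap.proj 2 + LinearMap.proj 3 +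
    k 3 • LinearMap.proj 4

/-- The homogeneous lift of a point to the paraboloid. -/
def paraboloidLift (p : Pt3) : Fin 5 → ℝ :=
  ![p 0, p 1, p 2, p 0 ^ 2 + p 1 ^ 2 + p 2 ^ 2, 1]

theorem sphereFunctional_apply (k : Fin 4 → ℝ) (X : Fin 5 → ℝ) :
    sphereFunctional k X = k 0 * X 0 + k 1 * X 1 + k 2 * X 2 + X 3 + k 3 * X 4 := by
  simp [sphereFunctional]

theorem sphereFunctional_lift (k : Fin 4 → ℝ) (p : Pt3) :
    sphereFunctional k (paraboloidLift p) =
      k 0 * p 0 + k 1 * p 1 + k 2 * p 2 + (p 0 ^ 2 + p 1 ^ 2 + p 2 ^ 2) + k 3 := by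
  rw [sphereFunctional_apply]
  simp [paraboloidLift]

theorem paraboloidLift_ne_zero (p : Pt3) : paraboloidLift p ≠ 0 := by
  intro h
  have := congrFun h 4
  simp [paraboloidLift] at this

theorem Pt3.ext_coord {p q : Pt3} (h0 : p 0 = q 0) (h1 : p 1 = q 1) (h2 : p 2 = q 2) : p = q := by
  ext i
  fin_cases i
  exacts [h0, h1, h2]

/-- A set without three distinct points is contained in a pair. -/
theorem exists_pair_cover {α : Type*} [Inhabited α] {Z : Set α}
    (h : ∀ a ∈ Z, ∀ b ∈ Z, ∀ c ∈ Z, a = b ∨ a = c ∨ b = c) :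
    ∃ z : α × α, ∀ q ∈ Z, q = z.1 ∨ q = z.2 := by
  by_cases h1 : ∃ a ∈ Z, ∃ b ∈ Z, a ≠ b
  · obtain ⟨a, ha, b, hb, hab⟩ := h1
    refine ⟨(a, b), fun q hq => ?_⟩
    rcases h a ha b hb q hq with h | h | h
    exacts [absurd h hab, Or.inl h.symm, Or.inr h.symm]
  · push Not at h1
    by_cases h2 : ∃ a, a ∈ Z
    · obtain ⟨a, ha⟩ := h2
      exact ⟨(a, a), fun q hq => Or.inl (h1 q hq a ha)⟩
    · exact ⟨default, fun q hq => absurd ⟨q, hq⟩ h2⟩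

/-- A nonvertical line meets a sphere in at most two points: no three points share two affine
conditions solvable for the first two coordinates and a sphere equation. -/
theorem line_sphere_at_most_two {Z : Set Pt3} {u₁ u₂ u₃ w₁ w₂ w₃ s t : ℝ} {k : Fin 4 → ℝ}
    (hN : u₁ * w₂ - u₂ * w₁ ≠ 0) (hu : ∀ q ∈ Z, u₁ * q 0 + u₂ * q 1 + u₃ * q 2 = s)
    (hw : ∀ q ∈ Z, w₁ * q 0 + w₂ * q 1 + w₃ * q 2 = t)
    (hk : ∀ q ∈ Z, sphereFunctional k (paraboloidLift q) = 0) :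
    ∀ a ∈ Z, ∀ b ∈ Z, ∀ c ∈ Z, a = b ∨ a = c ∨ b = c := by
  set N := u₁ * w₂ - u₂ * w₁ with hNd
  set m := (u₂ * w₃ - u₃ * w₂) / N with hm
  set l := (u₃ * w₁ - u₁ * w₃) / N with hl
  have diff : ∀ a ∈ Z, ∀ b ∈ Z, a 0 - b 0 = m * (a 2 - b 2) ∧ a 1 - b 1 = l * (a 2 - b 2) := by
    intro a ha b hb
    have e1 := hu a ha
    have e2 := hu b hb
    have e3 := hw a ha
    have e4 := hw b hb
    constructor
    · rw [hm, div_mul_eq_mul_div, eq_div_iff hN, hNd]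
      linear_combination w₂ * e1 - w₂ * e2 - u₂ * e3 + u₂ * e4
    · rw [hl, div_mul_eq_mul_div, eq_div_iff hN, hNd]
      linear_combination -w₁ * e1 + w₁ * e2 + u₁ * e3 - u₁ * e4
  have zeq : ∀ a ∈ Z, ∀ b ∈ Z, a 2 = b 2 → a = b := by
    intro a ha b hb h
    obtain ⟨h0, h1⟩ := diff a ha b hb
    rw [h, sub_self, mul_zero] at h0 h1
    exact Pt3.ext_coord (sub_eq_zero.1 h0) (sub_eq_zero.1 h1) h
  intro a ha b hb c hc
  by_contra! hne
  obtain ⟨n1, n2, n3⟩ := hne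
  have z1 : a 2 - b 2 ≠ 0 := fun h => n1 (zeq a ha b hb (sub_eq_zero.1 h))
  have z2 : a 2 - c 2 ≠ 0 := fun h => n2 (zeq a ha c hc (sub_eq_zero.1 h))
  have z3 : b 2 - c 2 ≠ 0 := fun h => n3 (zeq b hb c hc (sub_eq_zero.1 h))
  have ka := hk a ha
  have kb := hk b hb
  have kc := hk c hc
  rw [sphereFunctional_lift] at ka kb kc
  obtain ⟨b0, b1⟩ := diff b hb a ha
  obtain ⟨c0, c1⟩ := diff c hc a ha
  have eb0 : b 0 = a 0 + m * (b 2 - a 2) := by linarith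
  have eb1 : b 1 = a 1 + l * (b 2 - a 2) := by linarith
  have ec0 : c 0 = a 0 + m * (c 2 - a 2) := by linarith
  have ec1 : c 1 = a 1 + l * (c 2 - a 2) := by linarith
  rw [eb0, eb1] at kb
  rw [ec0, ec1] at kc
  set A := k 0 * m + k 1 * l + k 2 + 2 * (a 0 * m + a 1 * l + a 2) with hA
  have f1 : (b 2 - a 2) * (A + (m ^ 2 + l ^ 2 + 1) * (b 2 - a 2)) = 0 := by
    rw [hA]; linear_combination kb - ka
  have f2 : (c 2 - a 2) * (A + (m ^ 2 + l ^ 2 + 1) * (c 2 - a 2)) = 0 := by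
    rw [hA]; linear_combination kc - ka
  have g1 := (mul_eq_zero.1 f1).resolve_left (fun h => z1 (by linarith))
  have g2 := (mul_eq_zero.1 f2).resolve_left (fun h => z2 (by linarith))
  have g3 : (m ^ 2 + l ^ 2 + 1) * (b 2 - c 2) = 0 := by linear_combination g1 - g2
  rcases mul_eq_zero.1 g3 with h | h
  · nlinarith [sq_nonneg m, sq_nonneg l]
  · exact z3 h

theorem paraboloidLift_independent {a b c : Pt3} (hab : a ≠ b) (hac : a ≠ c) (hbc : b ≠ c)
    {x y z : ℝ} (h : x • paraboloidLift a + y • paraboloidLift b + z • paraboloidLift c = 0) :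
    x = 0 ∧ y = 0 ∧ z = 0 := by
  have e0 := congrFun h 0
  have e1 := congrFun h 1
  have e2 := congrFun h 2
  have e3 := congrFun h 3
  have e4 := congrFun h 4
  simp [paraboloidLift] at e0 e1 e2 e3 e4
  have hx : x = -y - z := by linarith
  subst hx
  have dist : ∀ p q : Pt3, p ≠ q → 0 < (p 0 - q 0) ^ 2 + (p 1 - q 1) ^ 2 + (p 2 - q 2) ^ 2 := by
    intro p q hpq
    by_contra! hle
    refine hpq (Pt3.ext_coord ?_ ?_ ?_) <;>
    nlinarith [sq_nonneg (p 0 - q 0), sq_nonneg (p 1 - q 1), sq_nonneg (p 2 - q 2)]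
  have dab := dist b a hab.symm
  have dac := dist c a hac.symm
  have dbc := dist b c hbc
  set B := (b 0 - a 0) ^ 2 + (b 1 - a 1) ^ 2 + (b 2 - a 2) ^ 2 with hB
  set C := (c 0 - a 0) ^ 2 + (c 1 - a 1) ^ 2 + (c 2 - a 2) ^ 2 with hC
  have f0 : y * (b 0 - a 0) + z * (c 0 - a 0) = 0 := by linear_combination e0
  have f1 : y * (b 1 - a 1) + z * (c 1 - a 1) = 0 := by linear_combination e1
  have f2 : y * (b 2 - a 2) + z * (c 2 - a 2) = 0 := by linear_combination e2
  have f3 : y * B + z * C = 0 := by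
    rw [hB, hC]
    linear_combination e3 - 2 * a 0 * f0 - 2 * a 1 * f1 - 2 * a 2 * f2
  have f4 : y ^ 2 * B = z ^ 2 * C := by
    rw [hB, hC]
    linear_combination (y * (b 0 - a 0) - z * (c 0 - a 0)) * f0 +
      (y * (b 1 - a 1) - z * (c 1 - a 1)) * f1 + (y * (b 2 - a 2) - z * (c 2 - a 2)) * f2
  have f5 : z * (y + z) * C = 0 := by linear_combination y * f3 - f4
  have hz : z = 0 ∨ y + z = 0 := by
    rcases mul_eq_zero.1 f5 with h | h
    · exact mul_eq_zero.1 h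
    · exact absurd h dac.ne'
  rcases hz with rfl | h
  · have : y = 0 := by
      have : y * B = 0 := by linarith
      exact (mul_eq_zero.1 this).resolve_right dab.ne'
    subst this
    simp
  · have hy : y = -z := by linarith
    subst hy
    by_cases hz : z = 0
    · simp [hz]
    · exfalso
      apply hbc
      refine Pt3.ext_coord ?_ ?_ ?_
      · exact mul_left_cancel₀ hz (by linarith)
      · exact mul_left_cancel₀ hz (by linarith)
      · exact mul_left_cancel₀ hz (by linarith)

section

variable {ι : Type*} [DecidableEq ι] {k : ι → Fin 4 → ℝ}

theorem three_spheres_at_most_two [Fintype ι] (hι : 5 ≤ Fintype.card ι)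
    (hk : InGeneralPosition fun c => sphereFunctional (k c)) {F : Finset ι} (hF : F.card = 3) :
    ∀ a ∈ {q | ∀ i ∈ F, sphereFunctional (k i) (paraboloidLift q) = 0},
    ∀ b ∈ {q | ∀ i ∈ F, sphereFunctional (k i) (paraboloidLift q) = 0},
    ∀ c ∈ {q | ∀ i ∈ F, sphereFunctional (k i) (paraboloidLift q) = 0},
      a = b ∨ a = c ∨ b = c := by
  intro a ha b hb c hc
  by_contra! hne
  obtain ⟨Q, hFQ, hQ⟩ := Finset.exists_superset_card_eq (s := F) (n := 5) (by omega) hι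
  let f : (Fin 3 → ℝ) →ₗ[ℝ] (↥(Q \ F) → ℝ) := LinearMap.pi fun i =>
    sphereFunctional (k i) ∘ₗ (LinearMap.proj 0).smulRight (paraboloidLift a) +
    sphereFunctional (k i) ∘ₗ (LinearMap.proj 1).smulRight (paraboloidLift b) +
    sphereFunctional (k i) ∘ₗ (LinearMap.proj 2).smulRight (paraboloidLift c)
  have hker : LinearMap.ker f ≠ ⊥ := by
    apply LinearMap.ker_ne_bot_of_finrank_lt
    simp only [Module.finrank_fintype_fun_eq_card, Fintype.card_coe, Fintype.card_fin]
    rw [Finset.card_sdiff_of_subset hFQ]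
    omega
  obtain ⟨x, hx, hx0⟩ := Submodule.exists_mem_ne_zero_of_ne_bot hker
  have hzero := hk Q hQ (x 0 • paraboloidLift a + x 1 • paraboloidLift b + x 2 • paraboloidLift c)
    (by
      intro i hi
      by_cases hiF : i ∈ F
      · simp only [map_add, map_smul]
        rw [ha i hiF, hb i hiF, hc i hiF]
        simp
      · have := congrFun (LinearMap.mem_ker.1 hx) ⟨i, Finset.mem_sdiff.2 ⟨hi, hiF⟩⟩
        simpa [f] using this)
  obtain ⟨h0, h1, h2⟩ := paraboloidLift_independent hne.1 hne.2.1 hne.2.2 hzero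
  apply hx0
  ext i
  fin_cases i
  exacts [h0, h1, h2]

end

section

variable {ι : Type*} [DecidableEq ι] {k : ι → Fin 4 → ℝ}

theorem continuous_sphereFunctional_lift (k : Fin 4 → ℝ) :
    Continuous fun q : Pt3 => sphereFunctional k (paraboloidLift q) := by
  simp only [sphereFunctional_lift]
  fun_prop

/-- The directional derivative at `q` of a sphere equation. -/
def sphereSlope (k : Fin 4 → ℝ) (q d : Pt3) : ℝ :=
  (k 0 + 2 * q 0) * d 0 + (k 1 + 2 * q 1) * d 1 + (k 2 + 2 * q 2) * d 2

theorem sphereFunctional_lift_add_smul (k : Fin 4 → ℝ) (q d : Pt3) (t : ℝ) :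
    sphereFunctional k (paraboloidLift (q + t • d)) = sphereFunctional k (paraboloidLift q) +
      t * (sphereSlope k q d + t * (d 0 ^ 2 + d 1 ^ 2 + d 2 ^ 2)) := by
  simp only [sphereFunctional_lift, sphereSlope, PiLp.add_apply, PiLp.smul_apply, smul_eq_mul]
  ring

theorem isCompact_closedCell {I R : Finset ι} (hIR : I ⊆ R) (hI : I.Nonempty) :
    IsCompact {q : Pt3 | InClosedCell (fun c => sphereFunctional (k c)) I R (paraboloidLift q)} := by
  have hcl : IsClosed {q : Pt3 |
      InClosedCell (fun c => sphereFunctional (k c)) I R (paraboloidLift q)} := by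
    simp only [InClosedCell, Set.ofPred_forall, Set.ofPred_and]
    refine isClosed_biInter fun c _ => (isClosed_iInter fun _ => ?_).inter (isClosed_iInter fun _ => ?_)
    · exact isClosed_le (continuous_sphereFunctional_lift _) continuous_const
    · exact isClosed_le continuous_const (continuous_sphereFunctional_lift _)
  obtain ⟨c, hc⟩ := hI
  set B := k c 0 ^ 2 + k c 1 ^ 2 + k c 2 ^ 2 + 2 * |k c 3| with hB
  refine (isCompact_closedBall (0 : Pt3) (√B)).of_isClosed_subset hcl fun q hq => ?_
  have h := (hq c (hIR hc)).1 hc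
  rw [sphereFunctional_lift] at h
  rw [mem_closedBall_zero_iff]
  apply Real.le_sqrt_of_sq_le
  rw [EuclideanSpace.real_norm_sq_eq, Fin.sum_univ_three, hB]
  nlinarith [sq_nonneg (k c 0 + q 0), sq_nonneg (k c 1 + q 1), sq_nonneg (k c 2 + q 2),
    neg_abs_le (k c 3)]

/-- A point is *downward critical* for a family of spheres through it when no downward direction
leaves all of them to the prescribed sides. -/
def DownwardCritical (k : ι → Fin 4 → ℝ) (F : Finset ι) (q : Pt3) : Prop :=
  ∃ I : Finset ι, ∀ d : Pt3, d 2 < 0 → ¬ ∀ c ∈ F,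
    (c ∈ I → sphereSlope (k c) q d < 0) ∧ (c ∉ I → 0 < sphereSlope (k c) q d)

theorem exists_downwardCritical {I R : Finset ι} (hIR : I ⊆ R) (hI : I.Nonempty) {p : Pt3}
    (hp : InClosedCell (fun c => sphereFunctional (k c)) I R (paraboloidLift p)) :
    ∃ q, InClosedCell (fun c => sphereFunctional (k c)) I R (paraboloidLift q) ∧
      DownwardCritical k (R.filter fun c => sphereFunctional (k c) (paraboloidLift q) = 0) q := by
  obtain ⟨q, hq, hmin⟩ := (isCompact_closedCell (k := k) hIR hI).exists_isMinOn ⟨p, hp⟩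
    (f := fun q : Pt3 => q 2) (by fun_prop)
  refine ⟨q, hq, I, fun d hd hall => ?_⟩
  have hcont : ∀ c, Continuous fun t : ℝ => sphereFunctional (k c) (paraboloidLift (q + t • d)) :=
    fun c => (continuous_sphereFunctional_lift (k c)).comp (by fun_prop)
  have hsl : ∀ c, Continuous fun t : ℝ => sphereSlope (k c) q d + t * (d 0 ^ 2 + d 1 ^ 2 + d 2 ^ 2) :=
    fun c => by fun_prop
  have hev : ∀ᶠ t in nhdsWithin (0 : ℝ) (Set.Ioi 0), ∀ c ∈ R,
      (c ∈ I → sphereFunctional (k c) (paraboloidLift (q + t • d)) ≤ 0) ∧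
      (c ∉ I → 0 ≤ sphereFunctional (k c) (paraboloidLift (q + t • d))) := by
    rw [Filter.eventually_all_finset]
    intro c hc
    by_cases h0 : sphereFunctional (k c) (paraboloidLift q) = 0
    · have hs := hall c (Finset.mem_filter.2 ⟨hc, h0⟩)
      by_cases hcI : c ∈ I
      · have := ((hsl c).tendsto 0).eventually_lt_const (u := 0) (by simpa using hs.1 hcI)
        filter_upwards [nhdsWithin_le_nhds this, self_mem_nhdsWithin] with t ht ht0
        refine ⟨fun _ => ?_, fun h => absurd hcI h⟩
        rw [sphereFunctional_lift_add_smul, h0, zero_add]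
        exact mul_nonpos_of_nonneg_of_nonpos (le_of_lt ht0) ht.le
      · have := ((hsl c).tendsto 0).eventually_const_lt (u := 0) (by simpa using hs.2 hcI)
        filter_upwards [nhdsWithin_le_nhds this, self_mem_nhdsWithin] with t ht ht0
        refine ⟨fun h => absurd h hcI, fun _ => ?_⟩
        rw [sphereFunctional_lift_add_smul, h0, zero_add]
        exact mul_nonneg (le_of_lt ht0) ht.le
    · by_cases hcI : c ∈ I
      · have := ((hcont c).tendsto 0).eventually_lt_const (u := 0)
          (by simpa using lt_of_le_of_ne ((hq c hc).1 hcI) h0)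
        filter_upwards [nhdsWithin_le_nhds this] with t ht
        exact ⟨fun _ => ht.le, fun h => absurd hcI h⟩
      · have := ((hcont c).tendsto 0).eventually_const_lt (u := 0)
          (by simpa using lt_of_le_of_ne ((hq c hc).2 hcI) (Ne.symm h0))
        filter_upwards [nhdsWithin_le_nhds this] with t ht
        exact ⟨fun h => absurd h hcI, fun _ => ht.le⟩
  obtain ⟨t, ht, ht0⟩ := (hev.and self_mem_nhdsWithin).exists
  have h1 : q 2 ≤ (q + t • d) 2 := hmin (show q + t • d ∈ {q : Pt3 | InClosedCell
    (fun c => sphereFunctional (k c)) I R (paraboloidLift q)} from ht)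
  have h2 : t * d 2 < 0 := mul_neg_of_pos_of_neg ht0 hd
  simp only [PiLp.add_apply, PiLp.smul_apply, smul_eq_mul] at h1
  linarith

theorem DownwardCritical.nonempty {F : Finset ι} {q : Pt3} (h : DownwardCritical k F q) :
    F.Nonempty := by
  obtain ⟨I, hI⟩ := h
  by_contra hF
  rw [Finset.not_nonempty_iff_eq_empty] at hF
  subst hF
  exact hI (!₂[0, 0, -1]) (by simp) (by simp)

theorem DownwardCritical.singleton {c : ι} {q : Pt3} (h : DownwardCritical k {c} q) :
    1 * q 0 + 0 * q 1 + 0 * q 2 = - k c 0 / 2 ∧ 0 * q 0 + 1 * q 1 + 0 * q 2 = - k c 1 / 2 := by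
  obtain ⟨I, hI⟩ := h
  set a := k c 0 + 2 * q 0 with ha
  set b := k c 1 + 2 * q 1 with hb
  set e := k c 2 + 2 * q 2 with he
  suffices hab : a ^ 2 + b ^ 2 = 0 by
    constructor
    · nlinarith [sq_nonneg a, sq_nonneg b]
    · nlinarith [sq_nonneg a, sq_nonneg b]
  by_contra hne
  have key : ∀ s : ℝ, sphereSlope (k c) q
      (!₂[a * (s + e) / (a ^ 2 + b ^ 2), b * (s + e) / (a ^ 2 + b ^ 2), -1]) = s := by
    intro s
    simp only [sphereSlope, ← ha, ← hb, ← he]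
    simp
    field_simp
    ring
  refine hI _ (?_ : (!₂[a * ((if c ∈ I then -1 else 1) + e) / (a ^ 2 + b ^ 2),
    b * ((if c ∈ I then -1 else 1) + e) / (a ^ 2 + b ^ 2), -1] : Pt3) 2 < 0) fun c' hc' => ?_
  · simp
  · rw [Finset.mem_singleton.1 hc', key]
    split_ifs with h <;> simp [h]

theorem DownwardCritical.pair {c c' : ι} {q : Pt3} (h : DownwardCritical k {c, c'} q)
    (hcc : c ≠ c') :
    (k c 0 + 2 * q 0) * (k c' 1 + 2 * q 1) = (k c 1 + 2 * q 1) * (k c' 0 + 2 * q 0) := by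
  obtain ⟨I, hI⟩ := h
  by_contra hne
  set a := k c 0 + 2 * q 0 with ha
  set b := k c 1 + 2 * q 1 with hb
  set e := k c 2 + 2 * q 2 with he
  set a' := k c' 0 + 2 * q 0 with ha'
  set b' := k c' 1 + 2 * q 1 with hb'
  set e' := k c' 2 + 2 * q 2 with he'
  have hN : a * b' - b * a' ≠ 0 := sub_ne_zero.2 hne
  have key : ∀ s s' : ℝ, ∃ d : Pt3, d 2 < 0 ∧ sphereSlope (k c) q d = s ∧
      sphereSlope (k c') q d = s' := by
    intro s s'
    refine ⟨!₂[(b' * (s + e) - b * (s' + e')) / (a * b' - b * a'),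
      (a * (s' + e') - a' * (s + e)) / (a * b' - b * a'), -1], by simp, ?_, ?_⟩
    · have : a * ((b' * (s + e) - b * (s' + e')) / (a * b' - b * a')) +
          b * ((a * (s' + e') - a' * (s + e)) / (a * b' - b * a')) = s + e := by
        rw [← mul_div_assoc, ← mul_div_assoc, ← add_div, div_eq_iff hN]
        ring
      simp only [sphereSlope, ← ha, ← hb, ← he]
      simp [this]
    · have : a' * ((b' * (s + e) - b * (s' + e')) / (a * b' - b * a')) +
          b' * ((a * (s' + e') - a' * (s + e)) / (a * b' - b * a')) = s' + e' := by
        rw [← mul_div_assoc, ← mul_div_assoc, ← add_div, div_eq_iff hN]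
        ring
      simp only [sphereSlope, ← ha', ← hb', ← he']
      simp [this]
  obtain ⟨d, hd, h1, h2⟩ := key (if c ∈ I then -1 else 1) (if c' ∈ I then -1 else 1)
  refine hI d hd fun x hx => ?_
  rcases Finset.mem_insert.1 hx with rfl | hx
  · rw [h1]
    split_ifs with h <;> simp [h]
  · rw [Finset.mem_singleton.1 hx, h2]
    split_ifs with h <;> simp [h]

/-- The possible lowest points of cells bounded by the spheres indexed by `F`. -/
def lowestPoints (k : ι → Fin 4 → ℝ) (F : Finset ι) : Set Pt3 :=
  {q | (∀ c ∈ F, sphereFunctional (k c) (paraboloidLift q) = 0) ∧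
    (F.card ≤ 2 → DownwardCritical k F q)}

theorem exists_pair_cover_lowestPoints [Fintype ι] (hι : 5 ≤ Fintype.card ι)
    (hk : InGeneralPosition fun c => sphereFunctional (k c))
    (hinj : Function.Injective fun c => k c 0) {F : Finset ι} (hF0 : F.Nonempty)
    (hF : F.card ≤ 3) :
    ∃ z : Pt3 × Pt3, ∀ q ∈ lowestPoints k F, q = z.1 ∨ q = z.2 := by
  apply exists_pair_cover
  have hpos := hF0.card_pos
  obtain h1 | h2 | h3 : F.card = 1 ∨ F.card = 2 ∨ F.card = 3 := by omega
  · obtain ⟨c, rfl⟩ := Finset.card_eq_one.1 h1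
    refine line_sphere_at_most_two (k := k c) (u₁ := 1) (u₂ := 0) (u₃ := 0) (w₁ := 0) (w₂ := 1)
      (w₃ := 0) (s := - k c 0 / 2) (t := - k c 1 / 2) (by norm_num) ?_ ?_ ?_
    · exact fun q hq => (hq.2 (by omega)).singleton.1
    · exact fun q hq => (hq.2 (by omega)).singleton.2
    · exact fun q hq => hq.1 c (Finset.mem_singleton_self c)
  · obtain ⟨c, c', hcc, rfl⟩ := Finset.card_eq_two.1 h2
    have hD : k c 0 - k c' 0 ≠ 0 := sub_ne_zero.2 fun h => hcc (hinj h)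
    set D₁ := k c 0 - k c' 0 with hD₁
    set D₂ := k c 1 - k c' 1 with hD₂
    refine line_sphere_at_most_two (k := k c) (u₁ := D₁) (u₂ := D₂) (u₃ := k c 2 - k c' 2)
      (w₁ := -2 * D₂) (w₂ := 2 * D₁) (w₃ := 0) (s := k c' 3 - k c 3)
      (t := k c 1 * k c' 0 - k c 0 * k c' 1) ?_ ?_ ?_ ?_
    · have : 0 < D₁ ^ 2 := by positivity
      nlinarith [sq_nonneg D₂]
    · intro q hq
      have e1 := hq.1 c (by simp)
      have e2 := hq.1 c' (by simp)
      rw [sphereFunctional_lift] at e1 e2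
      rw [hD₁, hD₂]
      linear_combination e1 - e2
    · intro q hq
      have e := (hq.2 (by omega)).pair hcc
      rw [hD₁, hD₂]
      linear_combination e
    · exact fun q hq => hq.1 c (by simp)
  · intro a ha b hb c hc
    exact three_spheres_at_most_two hι hk h3 a ha.1 b hb.1 c hc.1

/-- The sets of spheres that contain the points of `P` in their interiors, restricted to `R`. -/
def cellFamily (k : ι → Fin 4 → ℝ) (P : Finset Pt3) (R : Finset ι) : Finset (Finset ι) :=
  P.image fun p => R.filter fun c => sphereFunctional (k c) (paraboloidLift p) < 0

theorem card_cellFamily_le [Fintype ι] (hι : 5 ≤ Fintype.card ι)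
    (hk : InGeneralPosition fun c => sphereFunctional (k c))
    (hinj : Function.Injective fun c => k c 0) (P : Finset Pt3) {R : Finset ι} (hR : 4 ≤ R.card) :
    ((cellFamily k P R).card : ℝ) ≤ 260 * (R.card.descFactorial 3 : ℝ) := by
  classical
  set g : ι → Pt3 → ℝ := fun c q => sphereFunctional (k c) (paraboloidLift q) with hg
  choose z hz using fun F : {F : Finset ι // F.Nonempty ∧ F.card ≤ 3} =>
    exists_pair_cover_lowestPoints hι hk hinj F.2.1 F.2.2
  let z' : Finset ι → Pt3 × Pt3 := fun F => if h : F.Nonempty ∧ F.card ≤ 3 then z ⟨F, h⟩ else default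
  have hz' : ∀ F : Finset ι, F.Nonempty → F.card ≤ 3 → ∀ q ∈ lowestPoints k F,
      q = (z' F).1 ∨ q = (z' F).2 := by
    intro F h1 h2 q hq
    have := hz ⟨F, h1, h2⟩ q hq
    simpa only [z', dif_pos (And.intro h1 h2)] using this
  let 𝒮 : Finset (Finset ι) := R.powersetCard 1 ∪ R.powersetCard 2 ∪ R.powersetCard 3
  let 𝒬 : Finset Pt3 := 𝒮.biUnion fun F => {(z' F).1, (z' F).2}
  let tight : Pt3 → Finset ι := fun q => R.filter fun c => g c q = 0
  let out : Pt3 → Finset (Finset ι) := fun q => if (tight q).card ≤ 4 then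
    (tight q).powerset.image fun J => (R.filter fun c => g c q < 0) ∪ J else ∅
  have hsub : cellFamily k P R ⊆ insert ∅ (𝒬.biUnion out) := by
    intro I hI
    obtain ⟨p, -, rfl⟩ := Finset.mem_image.1 hI
    set I := R.filter fun c => sphereFunctional (k c) (paraboloidLift p) < 0 with hId
    rcases I.eq_empty_or_nonempty with h0 | h0
    · simp [h0]
    refine Finset.mem_insert_of_mem ?_
    have hp : InClosedCell (fun c => sphereFunctional (k c)) I R (paraboloidLift p) := by
      intro c hc
      constructor
      · intro h
        exact (Finset.mem_filter.1 h).2.le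
      · intro h
        by_contra! hlt
        exact h (Finset.mem_filter.2 ⟨hc, hlt⟩)
    obtain ⟨q, hq, hcrit⟩ := exists_downwardCritical (Finset.filter_subset _ _) h0 hp
    have ht4 : (tight q).card ≤ 4 := by
      by_contra! h
      obtain ⟨Q, hQ, hQ5⟩ := Finset.exists_subset_card_eq (show 5 ≤ (tight q).card from h)
      exact paraboloidLift_ne_zero q
        (hk Q hQ5 _ fun c hc => (Finset.mem_filter.1 (hQ hc)).2)
    have hq𝒬 : q ∈ 𝒬 := by
      have hF : ∃ F ∈ 𝒮, F.Nonempty ∧ F.card ≤ 3 ∧ q ∈ lowestPoints k F := by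
        have htpos := hcrit.nonempty
        by_cases h3 : 3 ≤ (tight q).card
        · obtain ⟨F, hF, hF3⟩ := Finset.exists_subset_card_eq h3
          refine ⟨F, ?_, Finset.card_pos.1 (by omega), by omega,
            fun c hc => (Finset.mem_filter.1 (hF hc)).2, fun h => by omega⟩
          simp only [𝒮, Finset.mem_union, Finset.mem_powersetCard]
          exact Or.inr ⟨hF.trans (Finset.filter_subset _ _), hF3⟩
        · refine ⟨tight q, ?_, htpos, by omega,
            fun c hc => (Finset.mem_filter.1 hc).2, fun _ => hcrit⟩
          have := htpos.card_pos
          have hs : tight q ⊆ R := Finset.filter_subset _ _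
          simp only [𝒮, Finset.mem_union, Finset.mem_powersetCard]
          have : (tight q).card = 1 ∨ (tight q).card = 2 := by
            change 0 < (tight q).card at this
            omega
          tauto
      obtain ⟨F, hF𝒮, hF0, hF3, hFq⟩ := hF
      refine Finset.mem_biUnion.2 ⟨F, hF𝒮, ?_⟩
      simpa using hz' F hF0 hF3 q hFq
    refine Finset.mem_biUnion.2 ⟨q, hq𝒬, ?_⟩
    simp only [out, if_pos ht4]
    refine Finset.mem_image.2 ⟨I ∩ tight q, Finset.mem_powerset.2 Finset.inter_subset_right, ?_⟩
    ext c
    simp only [Finset.mem_union, Finset.mem_filter, Finset.mem_inter, tight]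
    constructor
    · rintro (⟨hc, hlt⟩ | ⟨h, -⟩)
      · by_contra hcI
        exact absurd ((hq c hc).2 hcI) (not_le.2 hlt)
      · exact h
    · intro h
      have hc := (Finset.mem_filter.1 h).1
      rcases lt_or_eq_of_le ((hq c hc).1 h) with h' | h'
      · exact Or.inl ⟨hc, h'⟩
      · exact Or.inr ⟨h, hc, h'⟩
  have hout : ∀ q, (out q).card ≤ 16 := by
    intro q
    simp only [out]
    split_ifs with h
    · refine Finset.card_image_le.trans ?_
      rw [Finset.card_powerset]
      exact (Nat.pow_le_pow_right (by norm_num) h)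
    · simp
  set r := R.card with hr
  have h𝒮 : 𝒮.card ≤ r.choose 1 + r.choose 2 + r.choose 3 := by
    refine (Finset.card_union_le _ _).trans ?_
    rw [Finset.card_powersetCard]
    refine Nat.add_le_add_right ((Finset.card_union_le _ _).trans ?_) _
    rw [Finset.card_powersetCard, Finset.card_powersetCard]
  have h𝒬 : 𝒬.card ≤ 𝒮.card * 2 :=
    Finset.card_biUnion_le_card_mul _ _ _ fun F _ => Finset.card_le_two
  have htot : (cellFamily k P R).card ≤ 32 * (r.choose 1 + r.choose 2 + r.choose 3) + 1 := by
    refine (Finset.card_le_card hsub).trans ((Finset.card_insert_le _ _).trans ?_)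
    have := Finset.card_biUnion_le_card_mul 𝒬 out 16 fun q _ => hout q
    omega
  have hd : ∀ j, r.choose j ≤ r ^ j := fun j => Nat.choose_le_pow r j
  have hdesc : 3 * r ^ 3 ≤ 8 * r.descFactorial 3 := by
    obtain ⟨s, hs⟩ : ∃ s, r = s + 4 := ⟨r - 4, by omega⟩
    rw [hs]
    simp only [Nat.descFactorial]
    have e1 : s + 4 - 0 = s + 4 := rfl
    have e2 : s + 4 - 1 = s + 3 := by omega
    have e3 : s + 4 - 2 = s + 2 := by omega
    rw [e1, e2, e3]
    nlinarith [Nat.zero_le s, Nat.zero_le (s ^ 2), Nat.zero_le (s ^ 3)]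
  have h1 := hd 1
  have h2 := hd 2
  have h3 := hd 3
  have hr1 : r ^ 1 ≤ r ^ 3 := Nat.pow_le_pow_right (by omega) (by norm_num)
  have hr2 : r ^ 2 ≤ r ^ 3 := Nat.pow_le_pow_right (by omega) (by norm_num)
  have hr0 : 1 ≤ r ^ 3 := Nat.one_le_pow _ _ (by omega)
  have : (cellFamily k P R).card ≤ 260 * r.descFactorial 3 := by omega
  exact_mod_cast this

end

section

variable {ι : Type*} [DecidableEq ι]

open Polynomial in
theorem eventually_det_add_smul_ne_zero {n : ℕ} (A B : Matrix (Fin n) (Fin n) ℝ)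
    (hB : B.det ≠ 0) : ∀ᶠ x : ℝ in Filter.atTop, (x • A + B).det ≠ 0 := by
  set p : ℝ[X] := Matrix.det ((X : ℝ[X]) • A.map C + B.map C) with hp
  have hp0 : p ≠ 0 := by
    intro h
    have := Polynomial.coeff_det_X_add_C_zero A B
    rw [← hp, h, Polynomial.coeff_zero] at this
    exact hB this.symm
  filter_upwards [p.eventually_atTop_not_isRoot hp0] with x hx h
  apply hx
  rw [Polynomial.IsRoot, hp, ← Polynomial.coe_evalRingHom, RingHom.map_det, ← h]
  congr 1
  ext i j
  simp [-X_mul_C]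

/-- Sphere coefficients displaced along the moment curve. -/
def displaced (k : ι → Fin 4 → ℝ) (t : ι → ℝ) (x : ℝ) (c : ι) (j : Fin 4) : ℝ :=
  k c j + x⁻¹ * t c ^ (j.val + 1)

theorem eventually_inGeneralPosition_displaced [Fintype ι] (k : ι → Fin 4 → ℝ) {t : ι → ℝ}
    (ht : Function.Injective t) :
    ∀ᶠ x : ℝ in Filter.atTop, InGeneralPosition fun c => sphereFunctional (displaced k t x c) := by
  have hQ : ∀ Q : Finset ι, ∀ᶠ x : ℝ in Filter.atTop, Q.card = 5 → ∀ X : Fin 5 → ℝ,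
      (∀ i ∈ Q, sphereFunctional (displaced k t x i) X = 0) → X = 0 := by
    intro Q
    by_cases hQ5 : Q.card = 5
    · let e : Fin 5 ≃ Q := (Q.equivFinOfCardEq hQ5).symm
      let A : Matrix (Fin 5) (Fin 5) ℝ := Matrix.of fun i =>
        ![0, k (e i) 0, k (e i) 1, k (e i) 2, k (e i) 3]
      let B : Matrix (Fin 5) (Fin 5) ℝ := Matrix.vandermonde fun i => t (e i)
      have hB : B.det ≠ 0 := Matrix.det_vandermonde_ne_zero_iff.2
        (ht.comp (Subtype.val_injective.comp e.injective))
      filter_upwards [eventually_det_add_smul_ne_zero A B hB, Filter.eventually_gt_atTop 0]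
        with x hx hx0 _ X hX
      have hY := Matrix.eq_zero_of_mulVec_eq_zero hx (v := ![x * X 3, X 0, X 1, X 2, X 4]) (by
        ext i
        have := hX (e i) (e i).2
        rw [sphereFunctional_apply] at this
        simp only [displaced] at this
        have hxx : x * x⁻¹ = 1 := mul_inv_cancel₀ hx0.ne'
        simp [A, B, Matrix.mulVec, dotProduct, Fin.sum_univ_five, Matrix.vandermonde]
        simp at this
        linear_combination x * this - (t (e i) * X 0 + t (e i) ^ 2 * X 1 + t (e i) ^ 3 * X 2 +
          t (e i) ^ 4 * X 4) * hxx)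
      have h0 := congrFun hY 0
      have h1 := congrFun hY 1
      have h2 := congrFun hY 2
      have h3 := congrFun hY 3
      have h4 := congrFun hY 4
      simp [hx0.ne'] at h0 h1 h2 h3 h4
      ext i
      fin_cases i
      exacts [h1, h2, h3, h0, h4]
    · exact Filter.Eventually.of_forall fun x h => absurd h hQ5
  filter_upwards [Filter.eventually_all.2 hQ] with x hx Q hQ5
  exact hx Q hQ5

open Polynomial in
theorem eventually_injective_displaced [Fintype ι] (k : ι → Fin 4 → ℝ) {t : ι → ℝ}
    (ht : Function.Injective t) :
    ∀ᶠ x : ℝ in Filter.atTop, Function.Injective fun c => displaced k t x c 0 := by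
  have hcc : ∀ c c' : ι, ∀ᶠ x : ℝ in Filter.atTop,
      displaced k t x c 0 = displaced k t x c' 0 → c = c' := by
    intro c c'
    by_cases h : c = c'
    · exact Filter.Eventually.of_forall fun _ _ => h
    set p : ℝ[X] := C (k c 0 - k c' 0) * X + C (t c - t c') with hp
    have hp0 : p ≠ 0 := by
      intro h0
      have := congrArg (fun q => q.coeff 0) h0
      simp [hp] at this
      exact h (ht (sub_eq_zero.1 this))
    filter_upwards [p.eventually_atTop_not_isRoot hp0, Filter.eventually_gt_atTop 0] with x hx hx0 heq
    refine absurd ?_ hx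
    simp only [displaced, Fin.val_zero, zero_add, pow_one] at heq
    have hxx : x * x⁻¹ = 1 := mul_inv_cancel₀ hx0.ne'
    simp only [hp, IsRoot.def, eval_add, eval_mul, eval_C, eval_X]
    linear_combination x * heq - (t c - t c') * hxx
  filter_upwards [Filter.eventually_all.2 fun c => Filter.eventually_all.2 (hcc c)] with x hx c c' h
  exact hx c c' h

theorem eventually_sign_displaced [Finite ι] (k : ι → Fin 4 → ℝ) (t : ι → ℝ) (P : Finset Pt3)
    (hP : ∀ c, ∀ p ∈ P, sphereFunctional (k c) (paraboloidLift p) ≠ 0) :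
    ∀ᶠ x : ℝ in Filter.atTop, ∀ c, ∀ p ∈ P,
      0 < sphereFunctional (k c) (paraboloidLift p) *
        sphereFunctional (displaced k t x c) (paraboloidLift p) := by
  refine Filter.eventually_all.2 fun c => (Filter.eventually_all_finset P).2 fun p hp => ?_
  have hlim : Filter.Tendsto (fun x : ℝ => sphereFunctional (k c) (paraboloidLift p) *
      sphereFunctional (displaced k t x c) (paraboloidLift p)) Filter.atTop
      (nhds (sphereFunctional (k c) (paraboloidLift p) *
        sphereFunctional (k c) (paraboloidLift p))) := by
    refine Filter.Tendsto.const_mul _ ?_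
    simp only [sphereFunctional_lift]
    have hj : ∀ j, Filter.Tendsto (fun x : ℝ => displaced k t x c j) Filter.atTop
        (nhds (k c j)) := by
      intro j
      have := (tendsto_inv_atTop_zero (𝕜 := ℝ)).mul_const (t c ^ (j.val + 1))
      simpa [displaced] using this.const_add (k c j)
    exact (((((hj 0).mul_const _).add ((hj 1).mul_const _)).add ((hj 2).mul_const _)).add
      tendsto_const_nhds).add (hj 3)
  exact hlim.eventually_const_lt (mul_self_pos.2 (hP c p hp))

theorem exists_generic_spheres [Fintype ι] (k : ι → Fin 4 → ℝ) (P : Finset Pt3)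
    (hP : ∀ c, ∀ p ∈ P, sphereFunctional (k c) (paraboloidLift p) ≠ 0) :
    ∃ k' : ι → Fin 4 → ℝ, InGeneralPosition (fun c => sphereFunctional (k' c)) ∧
      (Function.Injective fun c => k' c 0) ∧ ∀ c, ∀ p ∈ P,
      0 < sphereFunctional (k c) (paraboloidLift p) *
        sphereFunctional (k' c) (paraboloidLift p) := by
  let t : ι → ℝ := fun c => (Fintype.equivFin ι c : ℕ)
  have ht : Function.Injective t := fun a b h =>
    (Fintype.equivFin ι).injective (Fin.ext (Nat.cast_injective h))
  obtain ⟨x, h1, h2, h3⟩ := ((eventually_inGeneralPosition_displaced k ht).and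
    ((eventually_injective_displaced k ht).and (eventually_sign_displaced k t P hP))).exists
  exact ⟨_, h1, h2, h3⟩

/-- Two nearby concentric spheres around every centre, with one radius slightly larger and one
slightly smaller than `α`. -/
def concentricCoeffs (α η : ℝ) (c : Pt3 × Bool) : Fin 4 → ℝ :=
  ![-2 * c.1 0, -2 * c.1 1, -2 * c.1 2,
    c.1 0 ^ 2 + c.1 1 ^ 2 + c.1 2 ^ 2 - α ^ 2 + if c.2 then -η else η]

theorem sphereFunctional_concentricCoeffs (α η : ℝ) (c : Pt3) (b : Bool) (p : Pt3) :
    sphereFunctional (concentricCoeffs α η (c, b)) (paraboloidLift p) =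
      ‖p - c‖ ^ 2 - α ^ 2 + if b then -η else η := by
  rw [sphereFunctional_lift, EuclideanSpace.real_norm_sq_eq, Fin.sum_univ_three]
  simp [concentricCoeffs]
  ring

/-- A generic family of spheres, two for each centre, that detects the distance `α`. -/
theorem exists_generic_concentric_spheres (P : Finset Pt3) {α : ℝ} (hα : 0 < α) :
    ∃ k : P × Bool → Fin 4 → ℝ, InGeneralPosition (fun c => sphereFunctional (k c)) ∧
      (Function.Injective fun c => k c 0) ∧
      (∀ c, ∀ p ∈ P, sphereFunctional (k c) (paraboloidLift p) ≠ 0) ∧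
      ∀ c : P, ∀ p ∈ P, ‖p - c‖ = α ↔
        (sphereFunctional (k (c, true)) (paraboloidLift p) < 0 ↔
          0 < sphereFunctional (k (c, false)) (paraboloidLift p)) := by
  classical
  obtain ⟨η, hη, hηlt⟩ : ∃ η : ℝ, 0 < η ∧ ∀ c ∈ P, ∀ p ∈ P, ‖p - c‖ ≠ α →
      η < |‖p - c‖ ^ 2 - α ^ 2| := by
    have : ∀ᶠ η in nhdsWithin (0 : ℝ) (Set.Ioi 0), ∀ c ∈ P, ∀ p ∈ P, ‖p - c‖ ≠ α →
        η < |‖p - c‖ ^ 2 - α ^ 2| := by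
      refine (Filter.eventually_all_finset P).2 fun c _ =>
        (Filter.eventually_all_finset P).2 fun p _ => ?_
      by_cases h : ‖p - c‖ = α
      · exact Filter.Eventually.of_forall fun _ h' => absurd h h'
      · have hpos : 0 < |‖p - c‖ ^ 2 - α ^ 2| := by
          rw [abs_pos, sub_ne_zero]
          intro h'
          exact h ((pow_left_inj₀ (norm_nonneg _) hα.le two_ne_zero).1 h')
        filter_upwards [nhdsWithin_le_nhds (Iio_mem_nhds hpos)] with η hη _
        exact hη
    obtain ⟨η, h1, h2⟩ := (this.and self_mem_nhdsWithin).exists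
    exact ⟨η, h2, h1⟩
  let k₀ : P × Bool → Fin 4 → ℝ := fun c => concentricCoeffs α η (c.1, c.2)
  have hk₀ : ∀ (c : P) (b : Bool) (p : Pt3), sphereFunctional (k₀ (c, b)) (paraboloidLift p) =
      ‖p - c‖ ^ 2 - α ^ 2 + if b then -η else η :=
    fun c b p => sphereFunctional_concentricCoeffs α η c b p
  have hne : ∀ c, ∀ p ∈ P, sphereFunctional (k₀ c) (paraboloidLift p) ≠ 0 := by
    rintro ⟨c, b⟩ p hp h0
    rw [hk₀] at h0
    by_cases h : ‖p - c‖ = α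
    · rw [h, sub_self, zero_add] at h0
      split_ifs at h0 <;> linarith
    · have := hηlt c c.2 p hp h
      rw [show ‖p - c‖ ^ 2 - α ^ 2 = -(if b then -η else η) by linarith] at this
      split_ifs at this
      · rw [neg_neg, abs_of_pos hη] at this
        exact lt_irrefl _ this
      · rw [abs_neg, abs_of_pos hη] at this
        exact lt_irrefl _ this
  obtain ⟨k, h1, h2, h3⟩ := exists_generic_spheres k₀ P hne
  refine ⟨k, h1, h2, fun c p hp h => ?_, fun c p hp => ?_⟩
  · have := h3 c p hp
    rw [h, mul_zero] at this
    exact lt_irrefl _ this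
  · have ht := h3 (c, true) p hp
    have hf := h3 (c, false) p hp
    rw [hk₀] at ht hf
    simp only [if_true, Bool.false_eq_true, if_false] at ht hf
    set a := sphereFunctional (k (c, true)) (paraboloidLift p)
    set b := sphereFunctional (k (c, false)) (paraboloidLift p)
    by_cases h : ‖p - c‖ = α
    · rw [h] at ht hf
      simp only [h, true_iff]
      have ha : a < 0 := by by_contra! h'; nlinarith
      have hb : 0 < b := by by_contra! h'; nlinarith
      exact ⟨fun _ => hb, fun _ => ha⟩
    · simp only [h, false_iff]
      intro hiff
      have hlt := hηlt c c.2 p hp h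
      set D := ‖p - c‖ ^ 2 - α ^ 2
      rcases lt_abs.1 hlt with h' | h'
      · have ha : 0 < a := by by_contra! h''; nlinarith
        have hb : 0 < b := by by_contra! h''; nlinarith
        exact absurd (hiff.2 hb) (not_lt.2 ha.le)
      · have ha : a < 0 := by by_contra! h''; nlinarith
        have hb : b < 0 := by by_contra! h''; nlinarith
        exact absurd (hiff.1 ha) (not_lt.2 hb.le)

end

section

variable {ι : Type*} [DecidableEq ι]
variable {k : ι → Fin 4 → ℝ}

/-- The spheres having points of `G` on both sides. -/
def crossing [Fintype ι] (k : ι → Fin 4 → ℝ) (G : Finset Pt3) : Finset ι :=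
  Finset.univ.filter fun c => (∃ p ∈ G, sphereFunctional (k c) (paraboloidLift p) < 0) ∧
    ∃ p ∈ G, 0 < sphereFunctional (k c) (paraboloidLift p)

theorem exists_small_hittingSet [Fintype ι] (𝓕 : Finset (Finset ι)) {K : ℕ}
    (h𝓕 : ∀ G ∈ 𝓕, K ≤ G.card) (hK : 1 ≤ K) (hKι : K ≤ Fintype.card ι)
    (hι : 5 ≤ Fintype.card ι) {L : ℝ} (hL : 4 ≤ L) (hcard : (𝓕.card : ℝ) < Real.exp L) :
    ∃ R : Finset ι, 5 ≤ R.card ∧ (R.card : ℝ) ≤ Fintype.card ι / K * (L + 6) ∧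
      ∀ G ∈ 𝓕, (R ∩ G).Nonempty := by
  set N := Fintype.card ι with hN
  have hN0 : (0 : ℝ) < N := by exact_mod_cast (by omega : 0 < N)
  have hK0 : (0 : ℝ) < K := by exact_mod_cast hK
  have hNK : (1 : ℝ) ≤ N / K := by
    rw [le_div_iff₀ hK0, one_mul]
    exact_mod_cast hKι
  set m := ⌈(N : ℝ) / K * L⌉₊ with hm
  have hm1 : (N : ℝ) / K * L ≤ m := Nat.le_ceil _
  have hm2 : (m : ℝ) < N / K * L + 1 := Nat.ceil_lt_add_one (by positivity)
  have hlt : 𝓕.card * (N - K) ^ m < N ^ m := by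
    have hreal : (𝓕.card : ℝ) * ((N : ℝ) - K) ^ m < (N : ℝ) ^ m := by
      have h1 : ((N : ℝ) - K) ^ m = (1 - K / N) ^ m * (N : ℝ) ^ m := by
        rw [← mul_pow]
        congr 1
        field_simp
      have h2 : (1 - (K : ℝ) / N) ^ m ≤ Real.exp (-L) := by
        have hb : 0 ≤ 1 - (K : ℝ) / N := by
          rw [sub_nonneg, div_le_one hN0]
          exact_mod_cast hKι
        calc (1 - (K : ℝ) / N) ^ m ≤ Real.exp (-(K / N)) ^ m :=
              pow_le_pow_left₀ hb (Real.one_sub_le_exp_neg _) m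
          _ = Real.exp (-(m * (K / N))) := by rw [← Real.exp_nat_mul]; ring_nf
          _ ≤ Real.exp (-L) := by
              apply Real.exp_le_exp.2
              have : (N : ℝ) / K * L * (K / N) ≤ m * (K / N) :=
                mul_le_mul_of_nonneg_right hm1 (by positivity)
              have h3 : (N : ℝ) / K * L * (K / N) = L := by field_simp
              linarith
      rw [h1, ← mul_assoc]
      apply mul_lt_of_lt_one_left (by positivity)
      calc (𝓕.card : ℝ) * (1 - K / N) ^ m ≤ 𝓕.card * Real.exp (-L) := by gcongr
        _ < Real.exp L * Real.exp (-L) := by gcongr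
        _ = 1 := by rw [← Real.exp_add, add_neg_cancel, Real.exp_zero]
    have : ((N - K : ℕ) : ℝ) = (N : ℝ) - K := Nat.cast_sub hKι
    rw [← this] at hreal
    exact_mod_cast hreal
  obtain ⟨R, hRm, hR⟩ := exists_hittingSet 𝓕 K m h𝓕 hlt
  have hRN : R.card ≤ N := Finset.card_le_univ R
  obtain ⟨R', hRR', hR'⟩ := Finset.exists_superset_card_eq (s := R) (n := max R.card 5)
    (le_max_left _ _) (max_le hRN hι)
  refine ⟨R', by rw [hR']; exact le_max_right _ _, ?_, fun G hG => ?_⟩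
  · have h1 : R'.card ≤ m + 5 := by
      rw [hR']
      exact max_le (by omega) (by omega)
    have h2 : (R'.card : ℝ) ≤ m + 5 := by exact_mod_cast h1
    nlinarith
  · exact (hR G hG).mono (Finset.inter_subset_inter_right hRR')

theorem card_simplexKeys [Fintype ι] :
    ((Fintype.piFinset fun _ : Fin 5 => (Finset.univ : Finset ι).powersetCard 4 ×ˢ
      (Finset.univ : Finset Bool)).card) ≤ (2 * Fintype.card ι ^ 4) ^ 5 := by
  rw [Fintype.card_piFinset_const, Finset.card_product, Finset.card_powersetCard]
  simp only [Finset.card_univ, Fintype.card_bool]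
  rw [mul_comm]
  exact Nat.pow_le_pow_left (Nat.mul_le_mul_left _ (Nat.choose_le_pow _ _)) _

/-- A cutting: the points lie in few cells, each crossed by fewer than `K` spheres. -/
theorem exists_cutting [Fintype ι] (hι : 5 ≤ Fintype.card ι)
    (hk : InGeneralPosition fun c => sphereFunctional (k c))
    (hinj : Function.Injective fun c => k c 0) (P : Finset Pt3)
    {K : ℕ} (hK : 1 ≤ K) (hKι : K ≤ Fintype.card ι) {lam : ℝ}
    (hlam : 1 + (harmonic (Fintype.card ι) : ℝ) ≤ lam) :
    ∃ 𝒞 : Finset (Finset Pt3),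
      (𝒞.card : ℝ) ≤ 256 * (2 * 16 ^ 4 * 260 * 20 ^ 3) * lam ^ 7 * (Fintype.card ι / K) ^ 3 ∧
      (∀ G ∈ 𝒞, G ⊆ P ∧ (crossing k G).card < K) ∧ ∀ p ∈ P, ∃ G ∈ 𝒞, p ∈ G := by
  classical
  set N := Fintype.card ι with hN
  set ℓ := fun c => sphereFunctional (k c) with hℓ
  have hN0 : (0 : ℝ) < N := by exact_mod_cast (by omega : 0 < N)
  have hW : Module.finrank ℝ (Fin 5 → ℝ) = 5 := by simp
  obtain ⟨v, hv⟩ := hk.exists_spansKernels hW hι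
  have hlog : Real.log N ≤ lam - 1 := by
    have h1 := log_add_one_le_harmonic N
    have h2 : Real.log N ≤ Real.log ((N + 1 : ℕ) : ℝ) :=
      Real.log_le_log hN0 (by exact_mod_cast Nat.le_succ N)
    linarith
  have hlog0 : 0 ≤ Real.log N := Real.log_natCast_nonneg N
  let cell : (Fin 5 → Finset ι × Bool) → Finset Pt3 := fun U =>
    P.filter fun p => paraboloidLift p ∈ simplicialCone v U
  let keys : Finset (Fin 5 → Finset ι × Bool) := Fintype.piFinset fun _ : Fin 5 =>
    (Finset.univ : Finset ι).powersetCard 4 ×ˢ (Finset.univ : Finset Bool)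
  let 𝓕 : Finset (Finset ι) := (keys.image fun U => crossing k (cell U)).filter fun F => K ≤ F.card
  have h𝓕card : (𝓕.card : ℝ) < Real.exp (20 * Real.log N + 4) := by
    have h1 : 𝓕.card ≤ (2 * N ^ 4) ^ 5 :=
      (Finset.card_filter_le _ _).trans (Finset.card_image_le.trans card_simplexKeys)
    have h2 : (𝓕.card : ℝ) ≤ 32 * (N : ℝ) ^ 20 := by
      have : (𝓕.card : ℝ) ≤ (2 * (N : ℝ) ^ 4) ^ 5 := by exact_mod_cast h1
      calc (𝓕.card : ℝ) ≤ (2 * (N : ℝ) ^ 4) ^ 5 := this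
        _ = 32 * (N : ℝ) ^ 20 := by ring
    have h3 : Real.exp (20 * Real.log N + 4) = (N : ℝ) ^ 20 * Real.exp 4 := by
      rw [Real.exp_add]
      congr 1
      rw [show (20 : ℝ) * Real.log N = ((20 : ℕ) : ℝ) * Real.log N by norm_num, Real.exp_nat_mul,
        Real.exp_log hN0]
    have h4 : (32 : ℝ) < Real.exp 4 := by
      have h5 := Real.exp_one_gt_d9
      have h6 : Real.exp 4 = Real.exp 1 ^ 4 := by rw [← Real.exp_nat_mul]; norm_num
      rw [h6]
      calc (32 : ℝ) < 2.7 ^ 4 := by norm_num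
        _ ≤ Real.exp 1 ^ 4 := pow_le_pow_left₀ (by norm_num) (by linarith) 4
    rw [h3]
    have : (0 : ℝ) < (N : ℝ) ^ 20 := by positivity
    nlinarith
  obtain ⟨R, hR5, hRle, hhit⟩ := exists_small_hittingSet 𝓕 (fun G hG => (Finset.mem_filter.1 hG).2)
    hK hKι hι (by linarith) h𝓕card
  set 𝓘 : Finset ι → Finset (Finset ι) := cellFamily k P with h𝓘d
  have hsub : ∀ R, ∀ I ∈ 𝓘 R, I ⊆ R := by
    intro R I hI
    obtain ⟨p, -, rfl⟩ := Finset.mem_image.1 hI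
    exact Finset.filter_subset _ _
  have herase : ∀ R, ∀ I ∈ 𝓘 R, ∀ h ∈ R, I.erase h ∈ 𝓘 (R.erase h) := by
    intro R I hI h _
    obtain ⟨p, hp, rfl⟩ := Finset.mem_image.1 hI
    exact Finset.mem_image.2 ⟨p, hp, Finset.filter_erase _ _ _⟩
  have hflags := card_vertexFlags_zero_le (M := 260) hι hk hv hsub herase (by norm_num) hlam
    (fun R hR => card_cellFamily_le hι hk hinj P hR) R (by omega)
  obtain ⟨𝒢, h𝒢card, h𝒢, hcover⟩ := exists_simplicialCone_cover (𝓘 := 𝓘) hW hk hv hR5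
  refine ⟨𝒢.image cell, ?_, ?_, ?_⟩
  · have h1 : ((𝒢.image cell).card : ℝ) ≤ 256 * ((vertexFlags ℓ v 𝓘 R 0).card : ℝ) := by
      exact_mod_cast Finset.card_image_le.trans h𝒢card
    have h2 : (R.card.descFactorial 3 : ℝ) ≤ (R.card : ℝ) ^ 3 := by
      exact_mod_cast Nat.descFactorial_le_pow R.card 3
    have h3 : (R.card : ℝ) ≤ N / K * (20 * lam) := by
      refine hRle.trans ?_
      gcongr
      linarith
    have hlam0 : 0 ≤ lam := by linarith
    have h4 : (R.card : ℝ) ^ 3 ≤ (N / K * (20 * lam)) ^ 3 := pow_le_pow_left₀ (by positivity) h3 3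
    calc ((𝒢.image cell).card : ℝ) ≤ 256 * ((vertexFlags ℓ v 𝓘 R 0).card : ℝ) := h1
      _ ≤ 256 * (2 * 16 ^ 4 * 260 * lam ^ 4 * (N / K * (20 * lam)) ^ 3) := by
          refine mul_le_mul_of_nonneg_left (hflags.trans ?_) (by norm_num)
          exact mul_le_mul_of_nonneg_left (h2.trans h4) (by positivity)
      _ = _ := by ring
  · intro G hG
    obtain ⟨U, hU, rfl⟩ := Finset.mem_image.1 hG
    refine ⟨Finset.filter_subset _ _, ?_⟩
    by_contra! hle
    have hmem : crossing k (cell U) ∈ 𝓕 := by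
      refine Finset.mem_filter.2 ⟨Finset.mem_image.2 ⟨U, ?_, rfl⟩, hle⟩
      refine Fintype.mem_piFinset.2 fun i => Finset.mem_product.2 ⟨?_, Finset.mem_univ _⟩
      exact Finset.mem_powersetCard.2 ⟨Finset.subset_univ _, (h𝒢 U hU).1 i⟩
    obtain ⟨c, hc⟩ := hhit _ hmem
    obtain ⟨hcR, hcc⟩ := Finset.mem_inter.1 hc
    obtain ⟨-, ⟨p, hp, hlt⟩, q, hq, hgt⟩ := Finset.mem_filter.1 hcc
    rcases (h𝒢 U hU).2 c hcR with h | h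
    · exact absurd (h _ (Finset.mem_filter.1 hq).2) (not_le.2 hgt)
    · exact absurd (h _ (Finset.mem_filter.1 hp).2) (not_le.2 hlt)
  · intro p hp
    obtain ⟨U, hU, hpU⟩ := hcover (R.filter fun c => sphereFunctional (k c) (paraboloidLift p) < 0)
      (Finset.mem_image.2 ⟨p, hp, rfl⟩) (Finset.filter_subset _ _) _ (paraboloidLift_ne_zero p)
      (fun c hc => ⟨fun h => (Finset.mem_filter.1 h).2.le, fun h => by
        by_contra! hlt
        exact h (Finset.mem_filter.2 ⟨hc, hlt⟩)⟩)
    exact ⟨cell U, Finset.mem_image_of_mem _ hU, Finset.mem_filter.2 ⟨hp, hpU⟩⟩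

end

theorem inner_sub_sub_eq_zero {α : ℝ} {p q u v : Pt3} (h1 : ‖p - u‖ = α) (h2 : ‖p - v‖ = α)
    (h3 : ‖q - u‖ = α) (h4 : ‖q - v‖ = α) : ⟪p - q, u - v⟫_ℝ = 0 := by
  have e1 := norm_sub_sq_real p u
  have e2 := norm_sub_sq_real p v
  have e3 := norm_sub_sq_real q u
  have e4 := norm_sub_sq_real q v
  rw [h1] at e1
  rw [h2] at e2
  rw [h3] at e3
  rw [h4] at e4
  simp only [inner_sub_left, inner_sub_right]
  linarith

/-- Three distinct points lie on at most two spheres of a given radius. -/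
theorem card_common_centres_le {α : ℝ} {F S : Finset Pt3} (hF : F.card = 3)
    (hS : ∀ c ∈ S, ∀ p ∈ F, ‖p - c‖ = α) : S.card ≤ 2 := by
  by_contra! hlt
  obtain ⟨u, hu, v, hv, w, hw, huv, huw, hvw⟩ := Finset.two_lt_card.1 hlt
  obtain ⟨a, b, c, hab, hac, hbc, rfl⟩ := Finset.card_eq_three.1 hF
  have h1 : AffineIndependent ℝ ![a, b, c] := by
    refine EuclideanGeometry.Cospherical.affineIndependent_of_ne ⟨u, α, ?_⟩ hab hac hbc
    intro p hp
    rw [dist_eq_norm]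
    exact hS u hu p (by simpa using hp)
  have h2 : AffineIndependent ℝ ![u, v, w] := by
    refine EuclideanGeometry.Cospherical.affineIndependent_of_ne ⟨a, α, ?_⟩ huv huw hvw
    intro p hp
    rw [dist_comm, dist_eq_norm]
    refine hS p ?_ a (by simp)
    simp only [Set.mem_insert_iff, Set.mem_singleton_iff] at hp
    rcases hp with rfl | rfl | rfl <;> assumption
  have f1 := h1.finrank_vectorSpan (n := 2) (by simp)
  have f2 := h2.finrank_vectorSpan (n := 2) (by simp)
  have hperp : vectorSpan ℝ (Set.range ![a, b, c]) ⟂ vectorSpan ℝ (Set.range ![u, v, w]) := by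
    rw [vectorSpan, vectorSpan, Submodule.isOrtho_span]
    rintro - ⟨p, ⟨i, rfl⟩, q, ⟨j, rfl⟩, rfl⟩ - ⟨r, ⟨l, rfl⟩, s, ⟨m, rfl⟩, rfl⟩
    have hp : ∀ i, ![a, b, c] i ∈ ({a, b, c} : Finset Pt3) := by
      intro i; fin_cases i <;> simp
    have hr : ∀ i, ![u, v, w] i ∈ S := by
      intro i; fin_cases i <;> assumption
    exact inner_sub_sub_eq_zero (hS _ (hr l) _ (hp i)) (hS _ (hr m) _ (hp i))
      (hS _ (hr l) _ (hp j)) (hS _ (hr m) _ (hp j))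
  have f3 := Submodule.finrank_mono hperp
  have f4 := Submodule.finrank_add_finrank_orthogonal (vectorSpan ℝ (Set.range ![u, v, w]))
  rw [finrank_euclideanSpace_fin] at f4
  omega

/-- The points of `E` at distance `α` from `c`. -/
def nbhd (α : ℝ) (E : Finset Pt3) (c : Pt3) : Finset Pt3 :=
  open Classical in E.filter fun p => ‖p - c‖ = α

theorem mem_nbhd {α : ℝ} {E : Finset Pt3} {c p : Pt3} :
    p ∈ nbhd α E c ↔ p ∈ E ∧ ‖p - c‖ = α := by
  simp [nbhd]

theorem nbhd_subset (α : ℝ) (E : Finset Pt3) (c : Pt3) : nbhd α E c ⊆ E :=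
  fun _ hp => (mem_nbhd.1 hp).1

theorem sum_card_nbhd_comm (α : ℝ) (S G : Finset Pt3) :
    ∑ c ∈ S, (nbhd α G c).card = ∑ p ∈ G, (nbhd α S p).card := by
  classical
  have := Finset.sum_card_bipartiteAbove_eq_sum_card_bipartiteBelow (s := S) (t := G)
    (fun c p => ‖p - c‖ = α)
  have h1 : ∀ c ∈ S, (nbhd α G c).card =
      (Finset.bipartiteAbove (fun c p => ‖p - c‖ = α) G c).card := by
    intro c _
    congr 1
  have h2 : ∀ p ∈ G, (nbhd α S p).card =
      (Finset.bipartiteBelow (fun c p => ‖p - c‖ = α) S p).card := by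
    intro p _
    congr 1
    ext q
    simp [mem_nbhd, Finset.bipartiteBelow, norm_sub_rev p q]
  rw [Finset.sum_congr rfl h1, this, Finset.sum_congr rfl h2]

theorem sum_choose_card_nbhd_le (α : ℝ) (S G : Finset Pt3) :
    ∑ c ∈ S, (nbhd α G c).card.choose 3 ≤ 2 * G.card.choose 3 := by
  classical
  have h1 := Finset.sum_card_bipartiteAbove_eq_sum_card_bipartiteBelow (s := S)
    (t := G.powersetCard 3) (fun c F => F ⊆ nbhd α G c)
  have h2 : ∀ c ∈ S, (nbhd α G c).card.choose 3 =
      (Finset.bipartiteAbove (fun c F => F ⊆ nbhd α G c) (G.powersetCard 3) c).card := by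
    intro c _
    rw [← Finset.card_powersetCard]
    congr 1
    ext F
    simp only [Finset.bipartiteAbove, Finset.mem_filter, Finset.mem_powersetCard]
    exact ⟨fun h => ⟨⟨h.1.trans (nbhd_subset _ _ _), h.2⟩, h.1⟩, fun h => ⟨h.2, h.1.2⟩⟩
  rw [Finset.sum_congr rfl h2, h1, mul_comm, ← Finset.card_powersetCard, ← smul_eq_mul]
  refine Finset.sum_le_card_nsmul _ _ _ fun F hF => ?_
  refine card_common_centres_le (α := α) (Finset.mem_powersetCard.1 hF).2 fun c hc p hp => ?_
  exact (mem_nbhd.1 ((Finset.mem_filter.1 hc).2 hp)).2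

theorem pow_three_le_choose (d : ℕ) : d ^ 3 ≤ 27 * d.choose 3 + 8 := by
  rcases lt_or_ge d 3 with h | h
  · interval_cases d <;> simp
  obtain ⟨s, rfl⟩ : ∃ s, d = s + 3 := ⟨d - 3, by omega⟩
  have h6 := Nat.descFactorial_eq_factorial_mul_choose (s + 3) 3
  have e : (s + 3).descFactorial 3 = (s + 1) * ((s + 2) * (s + 3)) := by
    simp only [Nat.descFactorial]
    have e1 : s + 3 - 0 = s + 3 := rfl
    have e2 : s + 3 - 1 = s + 2 := by omega
    have e3 : s + 3 - 2 = s + 1 := by omega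
    rw [e1, e2, e3]
    ring
  rw [e] at h6
  simp only [Nat.factorial] at h6
  nlinarith [Nat.zero_le s, Nat.zero_le (s ^ 2), Nat.zero_le (s ^ 3)]

theorem sum_card_nbhd_pow_three_le (α : ℝ) (S G : Finset Pt3) :
    (∑ c ∈ S, (nbhd α G c).card) ^ 3 ≤ S.card ^ 2 * (9 * G.card ^ 3 + 8 * S.card) := by
  refine (pow_sum_le_card_mul_sum_pow (fun _ _ => Nat.zero_le _) 2).trans ?_
  refine Nat.mul_le_mul_left _ ?_
  have h1 : ∑ c ∈ S, (nbhd α G c).card ^ (2 + 1) ≤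
      27 * ∑ c ∈ S, (nbhd α G c).card.choose 3 + 8 * S.card := by
    rw [Finset.mul_sum, mul_comm 8, ← smul_eq_mul S.card, ← Finset.sum_const,
      ← Finset.sum_add_distrib]
    exact Finset.sum_le_sum fun c _ => pow_three_le_choose _
  have h2 := sum_choose_card_nbhd_le α S G
  have h3 : 6 * G.card.choose 3 ≤ G.card ^ 3 := by
    have := Nat.descFactorial_eq_factorial_mul_choose G.card 3
    simp only [Nat.factorial] at this
    have h4 := Nat.descFactorial_le_pow G.card 3
    omega
  omega

/-- A cell crossed by few spheres contains few points with many neighbours. -/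
theorem card_cell_le {α : ℝ} {E G : Finset Pt3} {k : E × Bool → Fin 4 → ℝ}
    (hne : ∀ c, ∀ p ∈ E, sphereFunctional (k c) (paraboloidLift p) ≠ 0)
    (hiff : ∀ c : E, ∀ p ∈ E, ‖p - c‖ = α ↔
      (sphereFunctional (k (c, true)) (paraboloidLift p) < 0 ↔
        0 < sphereFunctional (k (c, false)) (paraboloidLift p)))
    (hGE : G ⊆ E) {K d : ℕ} (hcross : (crossing k G).card ≤ K) (hd : 8 ≤ d)
    (hKd : 1000 * K ^ 2 ≤ d ^ 3) (hdeg : ∀ p ∈ G, d ≤ (nbhd α E p).card) (hG : 3 ≤ G.card) :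
    d * G.card ≤ 4 * K := by
  classical
  let S₁ : Finset Pt3 := (crossing k G).image fun c => (c.1 : Pt3)
  let S₂ : Finset Pt3 := E.filter fun c => c ∉ S₁ ∧ (nbhd α G c).Nonempty
  have hS₁ : S₁.card ≤ K := Finset.card_image_le.trans hcross
  have hsame : ∀ c : E × Bool, c.1.1 ∉ S₁ → ∀ p ∈ G, ∀ q ∈ G,
      sphereFunctional (k c) (paraboloidLift p) < 0 →
      sphereFunctional (k c) (paraboloidLift q) < 0 := by
    intro c hc p hp q hq hlt
    by_contra hnl
    refine hc (Finset.mem_image.2 ⟨c, Finset.mem_filter.2 ⟨Finset.mem_univ _, ⟨p, hp, hlt⟩, q, hq,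
      lt_of_le_of_ne (not_lt.1 hnl) (hne c q (hGE hq)).symm⟩, rfl⟩)
  have hfull : ∀ c ∈ S₂, ∀ p ∈ G, ‖p - c‖ = α := by
    intro c hc p hp
    obtain ⟨hcE, hc₁, q, hq⟩ := Finset.mem_filter.1 hc
    obtain ⟨hqG, hqα⟩ := mem_nbhd.1 hq
    have hs : ∀ b, (sphereFunctional (k (⟨c, hcE⟩, b)) (paraboloidLift p) < 0 ↔
        sphereFunctional (k (⟨c, hcE⟩, b)) (paraboloidLift q) < 0) := fun b =>
      ⟨hsame (⟨c, hcE⟩, b) hc₁ p hp q hqG, hsame (⟨c, hcE⟩, b) hc₁ q hqG p hp⟩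
    have hpos : ∀ x ∈ G, (0 < sphereFunctional (k (⟨c, hcE⟩, false)) (paraboloidLift x) ↔
        ¬ sphereFunctional (k (⟨c, hcE⟩, false)) (paraboloidLift x) < 0) := by
      intro x hx
      rw [not_lt]
      exact ⟨le_of_lt, fun h => lt_of_le_of_ne h (hne _ x (hGE hx)).symm⟩
    have h1 := (hiff ⟨c, hcE⟩ q (hGE hqG)).1 hqα
    refine (hiff ⟨c, hcE⟩ p (hGE hp)).2 ?_
    rw [hpos p hp, hs, hs, ← hpos q hqG]
    exact h1
  have hS₂ : S₂.card ≤ 2 := by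
    obtain ⟨F, hFG, hF⟩ := Finset.exists_subset_card_eq hG
    exact card_common_centres_le hF fun c hc p hp => hfull c hc p (hFG hp)
  set x := G.card with hx
  set U := ∑ c ∈ S₁, (nbhd α G c).card with hU
  have hsum : d * x ≤ U + 2 * x := by
    calc d * x = ∑ p ∈ G, d := by rw [Finset.sum_const, smul_eq_mul, mul_comm]
      _ ≤ ∑ p ∈ G, (nbhd α E p).card := Finset.sum_le_sum hdeg
      _ = ∑ c ∈ E, (nbhd α G c).card := (sum_card_nbhd_comm α E G).symm
      _ ≤ ∑ c ∈ S₁ ∪ S₂, (nbhd α G c).card := by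
          apply Finset.sum_le_sum_of_ne_zero
          intro c hc h0
          rw [Finset.mem_union]
          by_cases hc₁ : c ∈ S₁
          · exact Or.inl hc₁
          · exact Or.inr (Finset.mem_filter.2 ⟨hc, hc₁, Finset.card_pos.1 (Nat.pos_of_ne_zero h0)⟩)
      _ ≤ U + ∑ c ∈ S₂, (nbhd α G c).card := by
          rw [← Finset.sum_union_inter]
          exact Nat.le_add_right _ _
      _ ≤ U + 2 * x := by
          refine Nat.add_le_add_left ?_ _
          refine (Finset.sum_le_card_nsmul _ _ x fun c _ =>
            Finset.card_le_card (nbhd_subset _ _ _)).trans ?_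
          exact Nat.mul_le_mul_right _ hS₂
  have hU3 : U ^ 3 ≤ K ^ 2 * (9 * x ^ 3 + 8 * K) :=
    (sum_card_nbhd_pow_three_le α S₁ G).trans (by gcongr)
  by_contra! hlt
  have h1 : 3 * (d * x) ≤ 4 * U := by nlinarith
  have h2 : 27 * (d ^ 3 * x ^ 3) ≤ 64 * U ^ 3 := by
    have := Nat.pow_le_pow_left h1 3
    nlinarith
  have h3 : 64 * K ^ 3 < d ^ 3 * x ^ 3 := by
    have := Nat.pow_lt_pow_left hlt (n := 3) (by norm_num)
    nlinarith
  have h4 : 1000 * K ^ 2 * x ^ 3 ≤ d ^ 3 * x ^ 3 := Nat.mul_le_mul_right _ hKd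
  nlinarith

/-- The points of `E` with at least `d` neighbours. -/
def richPoints (α : ℝ) (E : Finset Pt3) (d : ℕ) : Finset Pt3 :=
  E.filter fun p => d ≤ (nbhd α E p).card

theorem exists_crossing_parameter {n d : ℕ} (hd : 10 ≤ d) (hdn : d ≤ n) (hnd : n ≤ d ^ 2) :
    ∃ K : ℕ, 1 ≤ K ∧ K ≤ n ∧ 1000 * K ^ 2 ≤ d ^ 3 ∧ d * n ≤ 4000 * K ^ 2 ∧ d ≤ 64 * K := by
  set s := Nat.sqrt (d ^ 3 / 1000) with hs
  have hs1 : s * s ≤ d ^ 3 / 1000 := Nat.sqrt_le _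
  have hs2 : d ^ 3 / 1000 < (s + 1) * (s + 1) := Nat.lt_succ_sqrt _
  have hd3 : 1000 ≤ d ^ 3 := by
    calc 1000 = 10 ^ 3 := by norm_num
      _ ≤ d ^ 3 := Nat.pow_le_pow_left hd 3
  have hs0 : 1 ≤ s := by
    rw [hs, Nat.le_sqrt]
    omega
  have hs3 : d ^ 3 ≤ 4000 * s ^ 2 := by
    have : d ^ 3 < 1000 * ((s + 1) * (s + 1)) := by omega
    nlinarith
  have hs4 : 1000 * s ^ 2 ≤ d ^ 3 := by
    have : 1000 * (s * s) ≤ d ^ 3 := by omega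
    nlinarith
  rcases le_total s n with h | h
  · refine ⟨s, hs0, h, hs4, ?_, ?_⟩
    · nlinarith
    · by_contra! hlt
      nlinarith [Nat.pow_le_pow_left hlt.le 2]
  · refine ⟨n, by omega, le_rfl, ?_, ?_, by omega⟩
    · have := Nat.pow_le_pow_left h 2
      omega
    · nlinarith

theorem one_add_harmonic_le {n : ℕ} (hn : 1 ≤ n) :
    1 + (harmonic (2 * n) : ℝ) ≤ 3 + Real.log n := by
  have h1 := harmonic_le_one_add_log (2 * n)
  have h2 : Real.log ((2 * n : ℕ) : ℝ) = Real.log 2 + Real.log n := by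
    push_cast
    exact Real.log_mul (by norm_num) (by exact_mod_cast (by omega : n ≠ 0))
  have h3 := Real.log_two_lt_d9
  linarith

theorem exists_card_richPoints_le : ∃ C : ℝ, 0 < C ∧ ∀ (α : ℝ) (_ : 0 < α) (E : Finset Pt3) (d : ℕ),
    (d : ℝ) ^ 2 * (richPoints α E d).card ≤
      C * (3 + Real.log E.card) ^ 7 * (E.card : ℝ) ^ 2 := by
  classical
  obtain ⟨A, hA⟩ : ∃ A : ℝ, A = 256 * (2 * 16 ^ 4 * 260 * 20 ^ 3) := ⟨_, rfl⟩
  have hA0 : 100 ≤ A := by rw [hA]; norm_num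
  refine ⟨A * 8 * 528000, by positivity, fun α hα E d => ?_⟩
  set n := E.card with hn
  set m := (richPoints α E d).card with hm
  have hlog : 0 ≤ Real.log n := Real.log_natCast_nonneg n
  have hlam : 1 ≤ (3 + Real.log n) ^ 7 := one_le_pow₀ (by linarith)
  have hmn : m ≤ n := Finset.card_le_card (Finset.filter_subset _ _)
  suffices hmain : (d : ℝ) ^ 2 * m ≤ 100 * n ^ 2 ∨
      (d : ℝ) ^ 2 * m ≤ A * 8 * 528000 * (3 + Real.log n) ^ 7 * (n : ℝ) ^ 2 by
    rcases hmain with h | h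
    · refine h.trans (mul_le_mul_of_nonneg_right ?_ (by positivity))
      nlinarith
    · exact h
  rcases Nat.eq_zero_or_pos m with hm0 | hm0
  · left
    rw [hm0]
    simp
  have hdn : d ≤ n := by
    obtain ⟨p, hp⟩ := Finset.card_pos.1 hm0
    exact (Finset.mem_filter.1 hp).2.trans (Finset.card_le_card (nbhd_subset _ _ _))
  rcases lt_or_ge d 10 with hd | hd
  · left
    have : d ^ 2 * m ≤ 100 * n ^ 2 := by
      have h1 : d ^ 2 ≤ 100 := by nlinarith
      have h2 : m ≤ n ^ 2 := by nlinarith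
      exact Nat.mul_le_mul h1 h2
    exact_mod_cast this
  rcases lt_or_ge (d ^ 2) n with hnd | hnd
  · left
    have : d ^ 2 * m ≤ 100 * n ^ 2 := by nlinarith
    exact_mod_cast this
  right
  obtain ⟨K, hK1, hKn, hKd, hdnK, hdK⟩ := exists_crossing_parameter hd hdn hnd
  obtain ⟨k, hk, hinj, hne, hiff⟩ := exists_generic_concentric_spheres E hα
  have hι : Fintype.card (E × Bool) = 2 * n := by simp [mul_comm, hn]
  obtain ⟨𝒞, h𝒞, hcell, hcov⟩ := exists_cutting (by omega) hk hinj (richPoints α E d) hK1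
    (by omega) (lam := 3 + Real.log n) (by rw [hι]; exact one_add_harmonic_le (by omega))
  rw [hι, ← hA] at h𝒞
  have hsize : ∀ G ∈ 𝒞, d * G.card ≤ 132 * K := by
    intro G hG
    obtain ⟨hGr, hGK⟩ := hcell G hG
    rcases lt_or_ge G.card 3 with h | h
    · nlinarith
    · have := card_cell_le hne hiff (hGr.trans (Finset.filter_subset _ _)) hGK.le (by omega) hKd
        (fun p hp => (Finset.mem_filter.1 (hGr hp)).2) h
      omega
  have hcount : d * m ≤ 𝒞.card * (132 * K) := by
    have h1 : m ≤ ∑ G ∈ 𝒞, G.card := by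
      refine (Finset.card_le_card fun p hp => ?_).trans (Finset.card_biUnion_le (s := 𝒞) (t := id))
      obtain ⟨G, hG, hpG⟩ := hcov p hp
      exact Finset.mem_biUnion.2 ⟨G, hG, hpG⟩
    calc d * m ≤ d * ∑ G ∈ 𝒞, G.card := Nat.mul_le_mul_left _ h1
      _ = ∑ G ∈ 𝒞, d * G.card := Finset.mul_sum _ _ _
      _ ≤ 𝒞.card * (132 * K) := by
          rw [← smul_eq_mul]
          exact Finset.sum_le_card_nsmul _ _ _ hsize
  have hK0 : (0 : ℝ) < K := by exact_mod_cast hK1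
  have hcount' : (d : ℝ) * m ≤ 𝒞.card * (132 * K) := by exact_mod_cast hcount
  have hdnK' : (d : ℝ) * n ≤ 4000 * K ^ 2 := by exact_mod_cast hdnK
  have hfin : (d : ℝ) * (2 * n / K) ^ 3 * (132 * K) ≤ 8 * 528000 * n ^ 2 := by
    have : (d : ℝ) * (2 * n / K) ^ 3 * (132 * K) = 8 * 132 * n ^ 2 * ((d * n) / K ^ 2) := by
      field_simp
      ring
    rw [this]
    have h2 : (d : ℝ) * n / K ^ 2 ≤ 4000 := by
      rw [div_le_iff₀ (by positivity)]
      exact hdnK'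
    nlinarith [sq_nonneg (n : ℝ)]
  push_cast at h𝒞
  calc (d : ℝ) ^ 2 * m = d * (d * m) := by ring
    _ ≤ d * (𝒞.card * (132 * K)) := by gcongr
    _ ≤ d * (A * (3 + Real.log n) ^ 7 * (2 * n / K) ^ 3 * (132 * K)) := by gcongr
    _ = A * (3 + Real.log n) ^ 7 * (d * (2 * n / K) ^ 3 * (132 * K)) := by ring
    _ ≤ A * (3 + Real.log n) ^ 7 * (8 * 528000 * n ^ 2) := by gcongr
    _ = _ := by ring

theorem sum_card_nbhd_sq_le_sum_richPoints (α : ℝ) (E : Finset Pt3) :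
    ∑ p ∈ E, (nbhd α E p).card ^ 2 ≤
      ∑ j ∈ Finset.Icc 1 E.card, 2 * (j * (richPoints α E j).card) := by
  classical
  have h1 : ∀ p ∈ E, (nbhd α E p).card ^ 2 ≤
      ∑ j ∈ Finset.Icc 1 E.card, if j ≤ (nbhd α E p).card then 2 * j else 0 := by
    intro p _
    have hle : (nbhd α E p).card ≤ E.card := Finset.card_le_card (nbhd_subset _ _ _)
    have hg := Finset.sum_range_id_mul_two ((nbhd α E p).card + 1)
    rw [← Finset.sum_filter]
    have : (Finset.range ((nbhd α E p).card + 1)).filter (1 ≤ ·) ⊆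
        (Finset.Icc 1 E.card).filter (· ≤ (nbhd α E p).card) := by
      intro j hj
      simp only [Finset.mem_filter, Finset.mem_range, Finset.mem_Icc] at hj ⊢
      omega
    refine le_trans ?_ (Finset.sum_le_sum_of_subset this)
    have h0 : ∑ j ∈ (Finset.range ((nbhd α E p).card + 1)).filter (1 ≤ ·), 2 * j =
        ∑ j ∈ Finset.range ((nbhd α E p).card + 1), 2 * j := by
      apply Finset.sum_filter_of_ne
      intro j _ h
      omega
    rw [h0, ← Finset.mul_sum, mul_comm 2, hg, Nat.add_sub_cancel]
    nlinarith
  refine (Finset.sum_le_sum h1).trans (le_of_eq ?_)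
  rw [Finset.sum_comm]
  refine Finset.sum_congr rfl fun j _ => ?_
  rw [← Finset.sum_filter, Finset.sum_const, smul_eq_mul, richPoints]
  ring

theorem exists_sum_card_nbhd_sq_le : ∃ C : ℝ, 0 < C ∧ ∀ (α : ℝ) (_ : 0 < α) (E : Finset Pt3),
    ∑ p ∈ E, ((nbhd α E p).card : ℝ) ^ 2 ≤
      C * (3 + Real.log E.card) ^ 8 * (E.card : ℝ) ^ 2 := by
  obtain ⟨C, hC, hrich⟩ := exists_card_richPoints_le
  refine ⟨2 * C, by positivity, fun α hα E => ?_⟩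
  set n := E.card with hn
  have hlog : 0 ≤ Real.log n := Real.log_natCast_nonneg n
  set B := C * (3 + Real.log n) ^ 7 * (n : ℝ) ^ 2 with hB
  have h1 : ∑ p ∈ E, ((nbhd α E p).card : ℝ) ^ 2 ≤
      ∑ j ∈ Finset.Icc 1 n, 2 * ((j : ℝ) * (richPoints α E j).card) := by
    exact_mod_cast sum_card_nbhd_sq_le_sum_richPoints α E
  have h2 : ∀ j ∈ Finset.Icc 1 n, 2 * ((j : ℝ) * (richPoints α E j).card) ≤ 2 * B * (j : ℝ)⁻¹ := by
    intro j hj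
    have hj0 : (0 : ℝ) < j := by exact_mod_cast (Finset.mem_Icc.1 hj).1
    have := hrich α hα E j
    rw [← div_eq_mul_inv, le_div_iff₀ hj0]
    calc 2 * ((j : ℝ) * (richPoints α E j).card) * j =
          2 * ((j : ℝ) ^ 2 * (richPoints α E j).card) := by ring
      _ ≤ 2 * B := by linarith
  have h3 : ∑ j ∈ Finset.Icc 1 n, (j : ℝ)⁻¹ ≤ 3 + Real.log n := by
    have h4 := harmonic_le_one_add_log n
    rw [harmonic_eq_sum_Icc] at h4
    push_cast at h4
    linarith
  calc _ ≤ _ := h1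
    _ ≤ ∑ j ∈ Finset.Icc 1 n, 2 * B * (j : ℝ)⁻¹ := Finset.sum_le_sum h2
    _ = 2 * B * ∑ j ∈ Finset.Icc 1 n, (j : ℝ)⁻¹ := by rw [Finset.mul_sum]
    _ ≤ 2 * B * (3 + Real.log n) := by gcongr
    _ = _ := by rw [hB]; ring

/-- The second moment of the degrees in a distance graph in space is nearly quadratic. -/
theorem exists_sum_card_nbhd_sq_le_rpow {ε : ℝ} (hε : 0 < ε) : ∃ C : ℝ, 0 < C ∧
    ∀ (α : ℝ) (_ : 0 < α) (E : Finset Pt3),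
      ∑ p ∈ E, ((nbhd α E p).card : ℝ) ^ 2 ≤ C * (E.card : ℝ) ^ (2 + ε) := by
  obtain ⟨C, hC, hE⟩ := exists_sum_card_nbhd_sq_le
  refine ⟨C * (3 + 8 / ε) ^ 8, by positivity, fun α hα E => ?_⟩
  rcases Nat.eq_zero_or_pos E.card with h0 | h0
  · rw [Finset.card_eq_zero.1 h0]
    simp only [Finset.sum_empty]
    positivity
  set n := E.card with hn
  have hn1 : (1 : ℝ) ≤ n := by exact_mod_cast h0
  have hlog : 0 ≤ Real.log n := Real.log_natCast_nonneg n
  have h1 : Real.log n ≤ (n : ℝ) ^ (ε / 8) / (ε / 8) :=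
    Real.log_le_rpow_div (by positivity) (by positivity)
  have h2 : 1 ≤ (n : ℝ) ^ (ε / 8) := Real.one_le_rpow hn1 (by positivity)
  have h3 : 3 + Real.log n ≤ (3 + 8 / ε) * (n : ℝ) ^ (ε / 8) := by
    have : (n : ℝ) ^ (ε / 8) / (ε / 8) = 8 / ε * (n : ℝ) ^ (ε / 8) := by field_simp
    rw [this] at h1
    linarith
  have h4 : ((n : ℝ) ^ (ε / 8)) ^ 8 = (n : ℝ) ^ ε := by
    rw [← Real.rpow_natCast, ← Real.rpow_mul (by positivity)]
    congr 1
    push_cast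
    ring
  calc _ ≤ C * (3 + Real.log n) ^ 8 * (n : ℝ) ^ 2 := hE α hα E
    _ ≤ C * ((3 + 8 / ε) * (n : ℝ) ^ (ε / 8)) ^ 8 * (n : ℝ) ^ 2 := by gcongr
    _ = C * (3 + 8 / ε) ^ 8 * ((n : ℝ) ^ (2 : ℝ) * (n : ℝ) ^ ε) := by
        rw [mul_pow, h4, Real.rpow_two]
        ring
    _ = _ := by rw [← Real.rpow_add (by positivity)]

instance finiteTreeVert (c h : ℕ) : Finite (TreeVert c h) :=
  (List.finite_length_le (Fin c) h).to_subtype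

instance fintypeTreeVert (c h : ℕ) : Fintype (TreeVert c h) :=
  Fintype.ofFinite _

theorem finite_treeVert_maps (c h : ℕ) (E : Finset Pt3) :
    {φ : TreeVert c h → Pt3 | ∀ v, φ v ∈ E}.Finite := by
  have := Set.Finite.pi (ι := TreeVert c h) (t := fun _ => (E : Set Pt3))
    fun _ => E.finite_toSet
  refine this.subset fun φ hφ => ?_
  simpa using hφ

/-- The first coordinates of the points of a planar tree with infinite branching. -/
def treeAbscissa (α : ℝ) (l : List (Fin 2 × ℕ)) : ℝ :=
  α / (Encodable.encode l + 1)

theorem treeAbscissa_injective {α : ℝ} (hα : 0 < α) : Function.Injective (treeAbscissa α) := by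
  intro l l' h
  unfold treeAbscissa at h
  rw [div_eq_div_iff (by positivity) (by positivity)] at h
  have h1 := mul_left_cancel₀ hα.ne' h
  exact Encodable.encode_injective (by exact_mod_cast (add_right_cancel h1).symm)

theorem treeAbscissa_mem {α : ℝ} (hα : 0 < α) (l : List (Fin 2 × ℕ)) :
    0 ≤ treeAbscissa α l ∧ treeAbscissa α l ≤ α := by
  unfold treeAbscissa
  refine ⟨by positivity, div_le_self hα.le ?_⟩
  have : (0 : ℝ) ≤ (Encodable.encode l : ℕ) := Nat.cast_nonneg _
  linarith

/-- The second coordinates, chosen to make all edges of length `α`. -/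
def treeOrdinate (α : ℝ) : List (Fin 2 × ℕ) → ℝ
  | [] => 0
  | i :: l => treeOrdinate α l + √(α ^ 2 - (treeAbscissa α (i :: l) - treeAbscissa α l) ^ 2)

/-- A planar tree with infinite branching and all edges of length `α`. -/
def treePoint (α : ℝ) (l : List (Fin 2 × ℕ)) : Pt3 :=
  !₂[treeAbscissa α l, treeOrdinate α l, 0]

theorem treePoint_injective {α : ℝ} (hα : 0 < α) : Function.Injective (treePoint α) := by
  intro l l' h
  exact treeAbscissa_injective hα (by simpa [treePoint] using congrArg (fun p : Pt3 => p 0) h)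

theorem norm_treePoint_sub {α : ℝ} (hα : 0 < α) (i : Fin 2 × ℕ) (l : List (Fin 2 × ℕ)) :
    ‖treePoint α (i :: l) - treePoint α l‖ = α := by
  have h1 := treeAbscissa_mem hα (i :: l)
  have h2 := treeAbscissa_mem hα l
  have h3 : 0 ≤ α ^ 2 - (treeAbscissa α (i :: l) - treeAbscissa α l) ^ 2 := by
    nlinarith
  rw [EuclideanSpace.norm_eq, Fin.sum_univ_three]
  simp [treePoint, treeOrdinate, Real.sq_sqrt h3, Real.sqrt_sq hα.le]

/-- The list `l` with every entry labelled by the value of `g` at the vertex it leads to. -/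
def labelled (g : List (Fin 2) → ℕ) : List (Fin 2) → List (Fin 2 × ℕ)
  | [] => []
  | i :: l => (i, g (i :: l)) :: labelled g l

theorem map_fst_labelled (g : List (Fin 2) → ℕ) (l : List (Fin 2)) :
    (labelled g l).map Prod.fst = l := by
  induction l with
  | nil => rfl
  | cons i l ih => simp [labelled, ih]

theorem labelled_congr {g g' : List (Fin 2) → ℕ} {l : List (Fin 2)}
    (h : ∀ l', l' <:+ l → g l' = g' l') : labelled g l = labelled g' l := by
  induction l with
  | nil => rfl
  | cons i l ih =>
    rw [labelled, labelled, h _ List.suffix_rfl,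
      ih fun l' hl' => h l' (hl'.trans (List.suffix_cons i l))]

theorem eq_of_labelled_eq {g g' : List (Fin 2) → ℕ} {l : List (Fin 2)} (hl : l ≠ [])
    (h : labelled g l = labelled g' l) : g l = g' l := by
  cases l with
  | nil => exact absurd rfl hl
  | cons i l =>
    simp only [labelled, List.cons.injEq, Prod.mk.injEq] at h
    exact h.1.2

/-- The labelling of the leaves by `f`, with all other vertices labelled `0`. -/
def leafLabel {h m : ℕ} (f : List.Vector (Fin 2) h → Fin m) (l : List (Fin 2)) : ℕ :=
  if hl : l.length = h then f ⟨l, hl⟩ else 0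

theorem labelled_leafLabel {h m : ℕ} (f : List.Vector (Fin 2) h → Fin m) {l : List (Fin 2)}
    (hl : l.length ≤ h) : labelled (leafLabel f) l =
      labelled (fun l' => if l'.length = h then leafLabel f l else 0) l := by
  refine labelled_congr fun l' hl' => ?_
  by_cases h' : l'.length = h
  · have : l' = l := hl'.eq_of_length (le_antisymm hl'.length_le (by omega))
    subst this
    simp [h']
  · simp [leafLabel, h']

/-- The tree of height `h` whose leaves are replaced by `m` copies. -/
def blowupTree (α : ℝ) (h m : ℕ) : Finset Pt3 :=
  open Classical in
  (Finset.univ ×ˢ Finset.range m).image fun x : TreeVert 2 h × ℕ =>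
    treePoint α (labelled (fun l' => if l'.length = h then x.2 else 0) x.1.1)

theorem card_blowupTree_le (α : ℝ) (h m : ℕ) :
    (blowupTree α h m).card ≤ Nat.card (TreeVert 2 h) * m := by
  unfold blowupTree
  refine Finset.card_image_le.trans (le_of_eq ?_)
  rw [Finset.card_product, Finset.card_range, Finset.card_univ, Nat.card_eq_fintype_card]

theorem pow_le_ncard_distTreeConfigs3 {α : ℝ} (hα : 0 < α) {h m : ℕ} (hh : 1 ≤ h) (hm : 1 ≤ m)
    {E : Finset Pt3} (hE : blowupTree α h m ⊆ E) :
    m ^ 2 ^ h ≤ (distTreeConfigs3 2 h α E).ncard := by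
  classical
  let Φ : (List.Vector (Fin 2) h → Fin m) → TreeVert 2 h → Pt3 :=
    fun f v => treePoint α (labelled (leafLabel f) v.1)
  have hinj : Function.Injective Φ := by
    intro f f' hff
    ext ⟨l, hl⟩
    have h1 := treePoint_injective hα (congrFun hff ⟨l, hl.le⟩)
    have h2 := eq_of_labelled_eq (by rintro rfl; simp at hl; omega) h1
    simpa [leafLabel, hl] using h2
  have hsub : Set.range Φ ⊆ distTreeConfigs3 2 h α E := by
    rintro - ⟨f, rfl⟩
    refine ⟨fun v => hE ?_, fun v w hvw => ?_, ?_⟩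
    · refine Finset.mem_image.2 ⟨(v, leafLabel f v.1), ?_, ?_⟩
      · simp only [Finset.mem_product, Finset.mem_univ, true_and, Finset.mem_range]
        unfold leafLabel
        split_ifs with hv
        · exact (f _).2
        · exact hm
      · simp only [Φ, labelled_leafLabel f v.2]
    · have h1 := congrArg (List.map Prod.fst) (treePoint_injective hα hvw)
      rw [map_fst_labelled, map_fst_labelled] at h1
      exact Subtype.ext h1
    · rintro u v (⟨i, hi⟩ | ⟨i, hi⟩)
      · simp only [Φ, hi, labelled]
        exact norm_treePoint_sub hα _ _
      · simp only [Φ, hi, labelled]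
        rw [norm_sub_rev]
        exact norm_treePoint_sub hα _ _
  have hfin : (distTreeConfigs3 2 h α E).Finite :=
    (finite_treeVert_maps 2 h E).subset fun φ hφ => hφ.1
  calc m ^ 2 ^ h = Nat.card (List.Vector (Fin 2) h → Fin m) := by
        simp [Nat.card_eq_fintype_card, card_vector]
    _ = (Set.range Φ).ncard := (Nat.card_range_of_injective hinj).symm
    _ ≤ _ := Set.ncard_le_ncard hsub hfin

theorem exists_many_distTreeConfigs3 {α : ℝ} (hα : 0 < α) {h : ℕ} (hh : 1 ≤ h) :
    ∃ c' : ℝ, 0 < c' ∧ ∃ N : ℕ, ∀ n : ℕ, N < n → ∃ E : Finset Pt3, E.card = n ∧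
      c' * (n : ℝ) ^ (2 ^ h) ≤ ((distTreeConfigs3 2 h α E).ncard : ℝ) := by
  set T := Nat.card (TreeVert 2 h) with hT
  have : Nonempty (TreeVert 2 h) := ⟨⟨[], Nat.zero_le _⟩⟩
  have hT0 : 0 < T := Nat.card_pos
  have hT0' : (0 : ℝ) < T := by exact_mod_cast hT0
  refine ⟨(1 / (2 * T)) ^ 2 ^ h, by positivity, T, fun n hn => ?_⟩
  have hm : 1 ≤ n / T := (Nat.one_le_div_iff hT0).2 hn.le
  obtain ⟨E, hE, hcard⟩ := Infinite.exists_superset_card_eq (blowupTree α h (n / T)) n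
    ((card_blowupTree_le α h _).trans (Nat.mul_div_le n T))
  refine ⟨E, hcard, ?_⟩
  have h1 : (1 / (2 * T) : ℝ) * n ≤ (n / T : ℕ) := by
    have h2 : n ≤ 2 * T * (n / T) := by
      have := Nat.lt_mul_div_succ n hT0
      nlinarith
    have h3 : (n : ℝ) ≤ 2 * T * (n / T : ℕ) := by exact_mod_cast h2
    rw [div_mul_eq_mul_div, one_mul, div_le_iff₀ (by positivity)]
    linarith
  rw [← mul_pow]
  calc _ ≤ ((n / T : ℕ) : ℝ) ^ 2 ^ h := by gcongr
    _ ≤ _ := by exact_mod_cast pow_le_ncard_distTreeConfigs3 hα hh hm hE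

/-- The number of maps of the binary tree of height `h` into `E` sending the root to `x` and edges
to segments of length `α`. -/
def treeCount (α : ℝ) (E : Finset Pt3) : ℕ → Pt3 → ℕ
  | 0, _ => 1
  | h + 1, x => (∑ y ∈ nbhd α E x, treeCount α E h y) ^ 2

/-- Maps of the binary tree of height `h` into `E`, with root `x` and edges of length `α`. -/
def rootedTreeMaps (h : ℕ) (α : ℝ) (E : Finset Pt3) (x : Pt3) : Set (TreeVert 2 h → Pt3) :=
  {φ | (∀ v, φ v ∈ E) ∧ φ ⟨[], Nat.zero_le h⟩ = x ∧ ∀ u v, treeAdj 2 h u v → ‖φ u - φ v‖ = α}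

theorem finite_rootedTreeMaps (h : ℕ) (α : ℝ) (E : Finset Pt3) (x : Pt3) :
    (rootedTreeMaps h α E x).Finite :=
  (finite_treeVert_maps 2 h E).subset fun _ hφ => hφ.1

/-- The embedding of the tree of height `h` as the `i`-th branch of the tree of height `h + 1`. -/
def branch {h : ℕ} (i : Fin 2) (v : TreeVert 2 h) : TreeVert 2 (h + 1) :=
  ⟨v.1 ++ [i], by simpa using v.2⟩

theorem comp_branch_mem {h : ℕ} {α : ℝ} {E : Finset Pt3} {x : Pt3}
    {φ : TreeVert 2 (h + 1) → Pt3} (hφ : φ ∈ rootedTreeMaps (h + 1) α E x) (i : Fin 2) :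
    φ ∘ branch i ∈ ⋃ y ∈ nbhd α E x, rootedTreeMaps h α E y := by
  obtain ⟨hE, rfl, hadj⟩ := hφ
  refine Set.mem_biUnion (x := φ (branch i ⟨[], Nat.zero_le h⟩))
    (mem_nbhd.2 ⟨hE _, hadj _ _ (Or.inl ⟨i, rfl⟩)⟩) ⟨fun v => hE _, rfl, ?_⟩
  rintro u v (⟨j, hj⟩ | ⟨j, hj⟩)
  · exact hadj _ _ (Or.inl ⟨j, by simp [branch, hj]⟩)
  · exact hadj _ _ (Or.inr ⟨j, by simp [branch, hj]⟩)

theorem ncard_rootedTreeMaps_le (α : ℝ) (E : Finset Pt3) (h : ℕ) (x : Pt3) :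
    (rootedTreeMaps h α E x).ncard ≤ treeCount α E h x := by
  induction h generalizing x with
  | zero =>
    rw [treeCount, Set.ncard_le_one (finite_rootedTreeMaps 0 α E x)]
    intro φ hφ ψ hψ
    funext ⟨l, hl⟩
    obtain rfl := List.length_eq_zero_iff.1 (Nat.le_zero.1 hl)
    rw [hφ.2.1, hψ.2.1]
  | succ h ih =>
    set A := ⋃ y ∈ nbhd α E x, rootedTreeMaps h α E y with hA
    have hAfin : A.Finite := (nbhd α E x).finite_toSet.biUnion fun y _ =>
      finite_rootedTreeMaps h α E y
    have hAcard : A.ncard ≤ ∑ y ∈ nbhd α E x, treeCount α E h y :=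
      (Finset.set_ncard_biUnion_le _ _).trans (Finset.sum_le_sum fun y _ => ih y)
    have hmaps : ∀ φ ∈ rootedTreeMaps (h + 1) α E x, (φ ∘ branch 0, φ ∘ branch 1) ∈ A ×ˢ A :=
      fun φ hφ => ⟨comp_branch_mem hφ 0, comp_branch_mem hφ 1⟩
    have hinj : Set.InjOn (fun φ : TreeVert 2 (h + 1) → Pt3 => (φ ∘ branch 0, φ ∘ branch 1))
        (rootedTreeMaps (h + 1) α E x) := by
      intro φ hφ ψ hψ heq
      simp only [Prod.mk.injEq] at heq
      funext ⟨l, hl⟩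
      rcases List.eq_nil_or_concat' l with rfl | ⟨l', i, rfl⟩
      · rw [hφ.2.1, hψ.2.1]
      · have hl' : l'.length ≤ h := by simpa using hl
        fin_cases i
        · exact congrFun heq.1 ⟨l', hl'⟩
        · exact congrFun heq.2 ⟨l', hl'⟩
    have h1 := Set.ncard_le_ncard_of_injOn _ hmaps hinj (hAfin.prod hAfin)
    rw [Set.ncard_prod] at h1
    rw [treeCount, sq]
    exact h1.trans (Nat.mul_le_mul hAcard hAcard)

theorem ncard_distTreeConfigs3_le (α : ℝ) (E : Finset Pt3) (h : ℕ) :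
    (distTreeConfigs3 2 h α E).ncard ≤ ∑ x ∈ E, treeCount α E h x := by
  have hsub : distTreeConfigs3 2 h α E ⊆ ⋃ x ∈ E, rootedTreeMaps h α E x :=
    fun φ hφ => Set.mem_biUnion (hφ.1 ⟨[], Nat.zero_le h⟩) ⟨hφ.1, rfl, hφ.2.2⟩
  refine (Set.ncard_le_ncard hsub (E.finite_toSet.biUnion fun y _ =>
    finite_rootedTreeMaps h α E y)).trans ?_
  exact (Finset.set_ncard_biUnion_le _ _).trans
    (Finset.sum_le_sum fun x _ => ncard_rootedTreeMaps_le α E h x)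

theorem treeCount_succ_le (α : ℝ) (E : Finset Pt3) (h : ℕ) (x : Pt3) :
    treeCount α E (h + 1) x ≤ (∑ y ∈ E, treeCount α E h y) ^ 2 := by
  rw [treeCount]
  gcongr
  exact nbhd_subset α E x

theorem sum_treeCount_one (α : ℝ) (E : Finset Pt3) :
    ∑ x ∈ E, treeCount α E 1 x = ∑ x ∈ E, (nbhd α E x).card ^ 2 := by
  simp [treeCount]

theorem sum_treeCount_succ_le (α : ℝ) (E : Finset Pt3) (h : ℕ) :
    ∑ x ∈ E, treeCount α E (h + 1) x ≤ E.card * (∑ y ∈ E, treeCount α E h y) ^ 2 := by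
  rw [← smul_eq_mul]
  exact Finset.sum_le_card_nsmul _ _ _ fun x _ => treeCount_succ_le α E h x

theorem sum_treeCount_add_two_le (α : ℝ) (E : Finset Pt3) (h : ℕ) :
    ∑ x ∈ E, treeCount α E (h + 2) x ≤
      (∑ y ∈ E, treeCount α E h y) ^ 4 * ∑ x ∈ E, (nbhd α E x).card ^ 2 := by
  rw [Finset.mul_sum]
  refine Finset.sum_le_sum fun x _ => ?_
  rw [treeCount]
  calc _ ≤ ((nbhd α E x).card • (∑ y ∈ E, treeCount α E h y) ^ 2) ^ 2 := by
        gcongr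
        exact Finset.sum_le_card_nsmul _ _ _ fun y _ => treeCount_succ_le α E h y
    _ = _ := by
        rw [smul_eq_mul]
        ring

/-- The sums `∑ x ∈ E, treeCount α E h x` grow with exponent at most `e` in the size of `E`. -/
def TreeCountBound (h : ℕ) (e : ℝ) : Prop :=
  ∀ ε : ℝ, 0 < ε → ∃ C : ℝ, 0 < C ∧ ∀ (α : ℝ) (_ : 0 < α) (E : Finset Pt3), E.Nonempty →
    ((∑ x ∈ E, treeCount α E h x : ℕ) : ℝ) ≤ C * (E.card : ℝ) ^ (e + ε)

theorem treeCountBound_one : TreeCountBound 1 2 := by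
  intro ε hε
  obtain ⟨C, hC, hE⟩ := exists_sum_card_nbhd_sq_le_rpow hε
  refine ⟨C, hC, fun α hα E _ => ?_⟩
  rw [sum_treeCount_one]
  exact_mod_cast hE α hα E

theorem TreeCountBound.succ {h : ℕ} {e : ℝ} (he : TreeCountBound h e) :
    TreeCountBound (h + 1) (2 * e + 1) := by
  intro ε hε
  obtain ⟨C, hC, hE⟩ := he (ε / 2) (by positivity)
  refine ⟨C ^ 2, by positivity, fun α hα E hne => ?_⟩
  have hn : (0 : ℝ) < E.card := by exact_mod_cast hne.card_pos
  have h1 : ((∑ x ∈ E, treeCount α E (h + 1) x : ℕ) : ℝ) ≤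
      E.card * ((∑ y ∈ E, treeCount α E h y : ℕ) : ℝ) ^ 2 := by
    exact_mod_cast sum_treeCount_succ_le α E h
  calc _ ≤ _ := h1
    _ ≤ E.card * (C * (E.card : ℝ) ^ (e + ε / 2)) ^ 2 := by
        gcongr
        exact hE α hα E hne
    _ = C ^ 2 * ((E.card : ℝ) ^ (1 : ℝ) * (E.card : ℝ) ^ ((e + ε / 2) * (2 : ℕ))) := by
        rw [Real.rpow_mul_natCast hn.le, Real.rpow_one]
        ring
    _ = _ := by
        rw [← Real.rpow_add hn]
        congr 2
        push_cast
        ring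

theorem TreeCountBound.add_two {h : ℕ} {e : ℝ} (he : TreeCountBound h e) :
    TreeCountBound (h + 2) (4 * e + 2) := by
  intro ε hε
  obtain ⟨C, hC, hE⟩ := he (ε / 8) (by positivity)
  obtain ⟨B, hB, hEB⟩ := exists_sum_card_nbhd_sq_le_rpow (half_pos hε)
  refine ⟨C ^ 4 * B, by positivity, fun α hα E hne => ?_⟩
  have hn : (0 : ℝ) < E.card := by exact_mod_cast hne.card_pos
  have h1 : ((∑ x ∈ E, treeCount α E (h + 2) x : ℕ) : ℝ) ≤
      ((∑ y ∈ E, treeCount α E h y : ℕ) : ℝ) ^ 4 * ∑ x ∈ E, ((nbhd α E x).card : ℝ) ^ 2 := by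
    exact_mod_cast sum_treeCount_add_two_le α E h
  calc _ ≤ _ := h1
    _ ≤ (C * (E.card : ℝ) ^ (e + ε / 8)) ^ 4 * (B * (E.card : ℝ) ^ (2 + ε / 2)) := by
        gcongr
        · exact hE α hα E hne
        · exact hEB α hα E
    _ = C ^ 4 * B * ((E.card : ℝ) ^ ((e + ε / 8) * (4 : ℕ)) * (E.card : ℝ) ^ (2 + ε / 2)) := by
        rw [Real.rpow_mul_natCast hn.le]
        ring
    _ = _ := by
        rw [← Real.rpow_add hn]
        congr 2
        push_cast
        ring

theorem treeCountBound_odd (k : ℕ) :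
    TreeCountBound (2 * k + 1) (1 / 6 * (2 ^ (2 * k + 1 + 3) - 3 + (-1) ^ (2 * k + 1))) := by
  induction k with
  | zero =>
    convert treeCountBound_one using 1
    norm_num
  | succ k ih =>
    convert ih.add_two using 1
    · ring
    · simp only [pow_add, pow_mul]
      norm_num
      ring

theorem treeCountBound {h : ℕ} (hh : 1 ≤ h) :
    TreeCountBound h (1 / 6 * (2 ^ (h + 3) - 3 + (-1) ^ h)) := by
  rcases Nat.even_or_odd' h with ⟨k, rfl | rfl⟩
  · obtain ⟨k, rfl⟩ : ∃ j, k = j + 1 := ⟨k - 1, by omega⟩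
    convert (treeCountBound_odd k).succ using 1
    · ring
    · simp only [pow_add, pow_mul]
      norm_num
      ring
  · exact treeCountBound_odd k

/-- **perfect binary trees with constant weight in three dimensions.**
Fix `h ≥ 1` and `α > 0`.  Then `n^(2^h) ≲ f₃(T_{2,h,α}; n)`: there are `c' > 0` and `N`
such that for every `n > N` some set of `n` points in `ℝ³` has at least `c' · n^(2^h)`
distance `T_{2,h,α}`-configurations.  Moreover, for every `ε > 0`,
`f₃(T_{2,h,α}; n) ≲ n^((1/6)(2^(h+3) − 3 + (−1)^h) + ε)`: there are constants `C` and `N`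
such that for all `n > N`, every set of `n` points in `ℝ³` has at most
`C · n^((1/6)(2^(h+3) − 3 + (−1)^h) + ε)` distance `T_{2,h,α}`-configurations. -/
theorem distance_binaryTree_bounds_threeDim (h : ℕ) (hh : 1 ≤ h) (α : ℝ) (hα : 0 < α) :
    (∃ c' : ℝ, 0 < c' ∧ ∃ N : ℕ, ∀ n : ℕ, N < n →
      ∃ E : Finset Pt3, E.card = n ∧
        c' * (n : ℝ) ^ (2 ^ h) ≤ ((distTreeConfigs3 2 h α E).ncard : ℝ)) ∧
    (∀ ε : ℝ, 0 < ε →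
      ∃ C : ℝ, 0 < C ∧ ∃ N : ℕ, ∀ n : ℕ, N < n → ∀ E : Finset Pt3, E.card = n →
        ((distTreeConfigs3 2 h α E).ncard : ℝ) ≤
          C * (n : ℝ) ^ ((1 : ℝ) / 6 * (2 ^ (h + 3) - 3 + (-1 : ℝ) ^ h) + ε)) := by
  refine ⟨exists_many_distTreeConfigs3 hα hh, fun ε hε => ?_⟩
  obtain ⟨C, hC, hE⟩ := treeCountBound hh ε hε
  refine ⟨C, hC, 0, ?_⟩
  rintro n hn E rfl
  refine le_trans ?_ (hE α hα E (Finset.card_pos.1 hn))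
  exact_mod_cast ncard_distTreeConfigs3_le α E h
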